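/- arXiv:2311.14609 — 4 statements merged into one kernel-verified Lean document; each statement's English description precedes it below -/
import Mathlib

section
/- Gradient descent analysis (Lemma 1, main conclusion): let d₁, d₂ ∈ ℕ, (u₀,v₀) ∈ ℝ^{d₁}×ℝ^{d₂}, let F : ℝ^{d₁}×ℝ^{d₂} → ℝ₊ be continuously differentiable, and set A = {(u,v) : ‖(u,v) − (u₀,v₀)‖ ≤ 2·√(F(u₀,v₀)) + 1}. Let u* ∈ ℝ^{d₁} and D_n, L_n > 0 be such that: u ↦ F(u,v) is convex for all v ∈ ℝ^{d₂}; ‖(∇F)(u,v)‖ ≤ L_n for all (u,v) ∈ A; ‖(∇F)(u₁,v₁) − (∇F)(u₂,v₂)‖ ≤ L_n·‖(u₁,v₁) − (u₂,v₂)‖ for all (u₁,v₁),(u₂,v₂) ∈ A; and |F(u*,v) − F(u*,v₀)| ≤ D_n·‖u*‖·‖v − v₀‖ for all v with ‖v − v₀‖ ≤ √(2·F(u₀,v₀)). Define iterates u_{t+1} = u_t − λ·(∇_u F)(u_t,v_t) and v_{t+1} = v_t − λ·(∇_v F)(u_t,v_t) for t = 0,1,…,t_n−1, where t_n ≥ L_n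 and λ = 1/t_n. Then F(u_{t_n},v_{t_n}) ≤ F(u*,v₀) + D_n·‖u*‖·√(2·F(u₀,v₀)) + ‖u* − u₀‖²/2 + F(u₀,v₀)/t_n. -/
open scoped BigOperators

/-- The gradient of `F` with respect to its first (the `u`-) variable. -/
noncomputable def gradU {d1 d2 : ℕ}
    (F : EuclideanSpace ℝ (Fin d1) → EuclideanSpace ℝ (Fin d2) → ℝ)
    (u : EuclideanSpace ℝ (Fin d1)) (v : EuclideanSpace ℝ (Fin d2)) :
    EuclideanSpace ℝ (Fin d1) :=
  gradient (fun u' => F u' v) u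

/-- The gradient of `F` with respect to its second (the `v`-) variable. -/
noncomputable def gradV {d1 d2 : ℕ}
    (F : EuclideanSpace ℝ (Fin d1) → EuclideanSpace ℝ (Fin d2) → ℝ)
    (u : EuclideanSpace ℝ (Fin d1)) (v : EuclideanSpace ℝ (Fin d2)) :
    EuclideanSpace ℝ (Fin d2) :=
  gradient (F u) v

theorem gd_descent {H : Type*} [NormedAddCommGroup H] [InnerProductSpace ℝ H]
    (f : H → ℝ) (G : H → H) (hf : ∀ x, HasFDerivAt f (innerSL ℝ (G x)) x)
    (x d : H) (L : ℝ)
    (hL : ∀ s ∈ Set.Icc (0:ℝ) 1, ‖G (x + s • d) - G x‖ ≤ L * ‖s • d‖) :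
    f (x + d) ≤ f x + inner ℝ (G x) d + L / 2 * ‖d‖ ^ 2 := by
  have hd : ∀ s : ℝ, HasDerivAt
      (fun s : ℝ => f (x + s • d) - s * inner ℝ (G x) d - s ^ 2 * (L / 2 * ‖d‖ ^ 2))
      (inner ℝ (G (x + s • d)) d - inner ℝ (G x) d - s * L * ‖d‖ ^ 2) s := by
    intro s
    have h1 : HasDerivAt (fun s : ℝ => x + s • d) d s := by
      simpa using ((hasDerivAt_id s).smul_const d).const_add x
    have h2 := (hf (x + s • d)).comp_hasDerivAt s h1
    have h3 : HasDerivAt (fun s : ℝ => s * inner ℝ (G x) d) (inner ℝ (G x) d) s := by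
      simpa using (hasDerivAt_id s).mul_const (inner ℝ (G x) d)
    have h4 := (hasDerivAt_pow 2 s).mul_const (L / 2 * ‖d‖ ^ 2)
    refine ((h2.sub h3).sub h4).congr_deriv ?_
    simp
    ring
  have hanti : AntitoneOn
      (fun s : ℝ => f (x + s • d) - s * inner ℝ (G x) d - s ^ 2 * (L / 2 * ‖d‖ ^ 2))
      (Set.Icc 0 1) := by
    apply antitoneOn_of_deriv_nonpos (convex_Icc 0 1)
    · exact fun s _ => (hd s).continuousAt.continuousWithinAt
    · exact fun s _ => (hd s).differentiableAt.differentiableWithinAt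
    · intro s hs
      rw [interior_Icc] at hs
      rw [(hd s).deriv, ← inner_sub_left]
      have h1 := real_inner_le_norm (G (x + s • d) - G x) d
      have h2 := hL s ⟨hs.1.le, hs.2.le⟩
      rw [norm_smul, Real.norm_of_nonneg hs.1.le] at h2
      have h3 := mul_le_mul_of_nonneg_right h2 (norm_nonneg d)
      nlinarith
  have := hanti (a := 0) (b := 1) (by simp) (by simp) zero_le_one
  simp at this
  linarith

theorem gd_generic {H : Type*} [NormedAddCommGroup H] [InnerProductSpace ℝ H]
    (f : H → ℝ) (G : H → H) (hf : ∀ x, HasFDerivAt f (innerSL ℝ (G x)) x)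
    (f0 : ∀ x, 0 ≤ f x) (L : ℝ) (hLp : 0 < L) (t : ℕ) (ht : L ≤ t) (X : ℕ → H)
    (hb : ∀ x, ‖x - X 0‖ ≤ 2 * √(f (X 0)) + 1 → ‖G x‖ ≤ L)
    (hlip : ∀ x y, ‖x - X 0‖ ≤ 2 * √(f (X 0)) + 1 → ‖y - X 0‖ ≤ 2 * √(f (X 0)) + 1 →
      ‖G x - G y‖ ≤ L * ‖x - y‖)
    (hX : ∀ k < t, X (k + 1) = X k - (t : ℝ)⁻¹ • G (X k)) :
    ∀ k ≤ t, ‖X k - X 0‖ ≤ √(2 * f (X 0)) ∧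
      (t : ℝ)⁻¹ / 2 * ∑ s ∈ Finset.range k, ‖G (X s)‖ ^ 2 ≤ f (X 0) - f (X k) ∧
      ∀ s < k, f (X k) ≤ f (X s) := by
  have htp : (0:ℝ) < t := hLp.trans_le ht
  have hlt : L * (t:ℝ)⁻¹ ≤ 1 := by
    rw [← div_eq_mul_inv]; exact (div_le_one htp).2 ht
  have htt : (t:ℝ) * (t:ℝ)⁻¹ = 1 := mul_inv_cancel₀ htp.ne'
  have hip : 0 < (t:ℝ)⁻¹ := inv_pos.2 htp
  have hsq : √(2 * f (X 0)) ≤ 2 * √(f (X 0)) := by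
    apply Real.sqrt_le_iff.2 ⟨by positivity, ?_⟩
    rw [mul_pow, Real.sq_sqrt (f0 _)]; linarith [f0 (X 0)]
  have hdiff : ∀ k ≤ t, X k - X 0 = - ((t:ℝ)⁻¹ • ∑ s ∈ Finset.range k, G (X s)) := by
    intro k
    induction k with
    | zero => simp
    | succ k ih =>
      intro hk
      rw [hX k (by omega), Finset.sum_range_succ, smul_add, sub_right_comm, ih (by omega)]
      abel
  intro k
  induction k with
  | zero => simp
  | succ k ih =>
    intro hk
    obtain ⟨ih1, ih2, ih3⟩ := ih (by omega)
    have hGk := hb (X k) (by linarith)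
    have hdesc := gd_descent f G hf (X k) (-((t:ℝ)⁻¹ • G (X k))) L (by
      intro s hs
      have : ‖s • (-((t:ℝ)⁻¹ • G (X k)))‖ ≤ 1 := by
        rw [norm_smul, norm_neg, norm_smul, Real.norm_of_nonneg hs.1, Real.norm_of_nonneg hip.le]
        have h1 : (t:ℝ)⁻¹ * ‖G (X k)‖ ≤ 1 := by nlinarith
        exact mul_le_one₀ hs.2 (by positivity) h1
      have h2 := hlip (X k + s • (-((t:ℝ)⁻¹ • G (X k)))) (X k) (by
        rw [add_sub_right_comm]
        refine (norm_add_le _ _).trans ?_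
        linarith) (by linarith)
      simpa using h2)
    rw [← sub_eq_add_neg, ← hX k (by omega), inner_neg_right, real_inner_smul_right,
      real_inner_self_eq_norm_sq, norm_neg, norm_smul, Real.norm_of_nonneg hip.le] at hdesc
    have hstep : f (X (k+1)) ≤ f (X k) - (t:ℝ)⁻¹ / 2 * ‖G (X k)‖ ^ 2 := by
      have : L * (t:ℝ)⁻¹ * ((t:ℝ)⁻¹ * ‖G (X k)‖ ^ 2) ≤ 1 * ((t:ℝ)⁻¹ * ‖G (X k)‖ ^ 2) :=
        mul_le_mul_of_nonneg_right hlt (by positivity)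
      nlinarith
    have hmono : f (X (k+1)) ≤ f (X k) := by
      have : 0 ≤ (t:ℝ)⁻¹ / 2 * ‖G (X k)‖ ^ 2 := by positivity
      linarith
    have hsum : (t : ℝ)⁻¹ / 2 * ∑ s ∈ Finset.range (k+1), ‖G (X s)‖ ^ 2
        ≤ f (X 0) - f (X (k+1)) := by
      rw [Finset.sum_range_succ, mul_add]; linarith
    refine ⟨?_, hsum, ?_⟩
    · rw [hdiff _ hk, norm_neg, norm_smul, Real.norm_of_nonneg hip.le]
      apply Real.le_sqrt_of_sq_le
      have h1 : ‖∑ s ∈ Finset.range (k+1), G (X s)‖ ^ 2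
          ≤ (t:ℝ) * ∑ s ∈ Finset.range (k+1), ‖G (X s)‖ ^ 2 := by
        have a1 := norm_sum_le (Finset.range (k+1)) (fun s => G (X s))
        have a2 := sq_sum_le_card_mul_sum_sq (s := Finset.range (k+1)) (f := fun s => ‖G (X s)‖)
        rw [Finset.card_range] at a2
        have a3 : ((k+1 : ℕ):ℝ) ≤ t := by exact_mod_cast hk
        calc _ ≤ (∑ s ∈ Finset.range (k+1), ‖G (X s)‖) ^ 2 := by gcongr
          _ ≤ _ := a2
          _ ≤ _ := by gcongr
      rw [mul_pow]
      calc (t:ℝ)⁻¹ ^ 2 * ‖∑ s ∈ Finset.range (k+1), G (X s)‖ ^ 2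
          ≤ (t:ℝ)⁻¹ ^ 2 * ((t:ℝ) * ∑ s ∈ Finset.range (k+1), ‖G (X s)‖ ^ 2) := by gcongr
        _ = 2 * ((t:ℝ)⁻¹ / 2 * ∑ s ∈ Finset.range (k+1), ‖G (X s)‖ ^ 2) := by
          field_simp
        _ ≤ _ := by linarith [f0 (X (k+1))]
    · intro s hs
      rcases Nat.lt_succ_iff_lt_or_eq.1 hs with h | h
      · exact hmono.trans (ih3 s h)
      · rw [h]; exact hmono

theorem gd_convex {E : Type*} [NormedAddCommGroup E] [InnerProductSpace ℝ E] [CompleteSpace E]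
    (f : E → ℝ) (hc : ConvexOn ℝ Set.univ f) (x y : E) (hf : DifferentiableAt ℝ f x) :
    f x - f y ≤ inner ℝ (gradient f x) (x - y) := by
  have hl : HasDerivAt (fun s : ℝ => AffineMap.lineMap x y s) (y - x) 0 :=
    AffineMap.hasDerivAt_lineMap
  have hg := hf.hasGradientAt.hasFDerivAt
  have h0 : (AffineMap.lineMap x y (0:ℝ) : E) = x := by simp
  rw [← h0] at hg
  have h1 := hg.comp_hasDerivAt (0:ℝ) hl
  have hc' := hc.comp_affineMap (AffineMap.lineMap (k := ℝ) x y)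
  have := hc'.le_slope_of_hasDerivAt (x := 0) (y := 1) (by simp) (by simp) zero_lt_one h1
  simp only [slope_def_field, InnerProductSpace.toDual_apply_apply, Function.comp_apply,
    AffineMap.lineMap_apply_zero, AffineMap.lineMap_apply_one, sub_zero, div_one] at this
  rw [← neg_sub y x, inner_neg_right]
  linarith

/-- Lemma 1 (main conclusion): bound on the empirical risk after `t_n` gradient descent
steps with step size `λ = 1/t_n`, for a nonnegative continuously differentiable function
`F(u,v)` which is convex in `u`, whose (joint) gradient is bounded by `L_n` and
`L_n`-Lipschitz on the ball `A` of radius `2·√F(u₀,v₀)+1` around `(u₀,v₀)`, and which is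
`D_n·‖u*‖`-Lipschitz in `v` at `u*` near `v₀`.  Here `‖(u,v)‖ = √(‖u‖²+‖v‖²)` and
`∇F = (∇_u F, ∇_v F)`. -/
theorem gradient_descent_risk_bound
    (d1 d2 : ℕ)
    (F : EuclideanSpace ℝ (Fin d1) → EuclideanSpace ℝ (Fin d2) → ℝ)
    (hF0 : ∀ u v, 0 ≤ F u v)
    (hFsmooth : ContDiff ℝ 1
      (fun p : EuclideanSpace ℝ (Fin d1) × EuclideanSpace ℝ (Fin d2) => F p.1 p.2))
    (u0 : EuclideanSpace ℝ (Fin d1)) (v0 : EuclideanSpace ℝ (Fin d2))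
    (ustar : EuclideanSpace ℝ (Fin d1))
    (Dn Ln : ℝ) (hDn : 0 < Dn) (hLn : 0 < Ln)
    (hconv : ∀ v, ConvexOn ℝ Set.univ (fun u => F u v))
    (hgradbound : ∀ u v,
      Real.sqrt (‖u - u0‖ ^ 2 + ‖v - v0‖ ^ 2) ≤ 2 * Real.sqrt (F u0 v0) + 1 →
      Real.sqrt (‖gradU F u v‖ ^ 2 + ‖gradV F u v‖ ^ 2) ≤ Ln)
    (hgradlip : ∀ u1 v1 u2 v2,
      Real.sqrt (‖u1 - u0‖ ^ 2 + ‖v1 - v0‖ ^ 2) ≤ 2 * Real.sqrt (F u0 v0) + 1 →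
      Real.sqrt (‖u2 - u0‖ ^ 2 + ‖v2 - v0‖ ^ 2) ≤ 2 * Real.sqrt (F u0 v0) + 1 →
      Real.sqrt (‖gradU F u1 v1 - gradU F u2 v2‖ ^ 2 + ‖gradV F u1 v1 - gradV F u2 v2‖ ^ 2)
        ≤ Ln * Real.sqrt (‖u1 - u2‖ ^ 2 + ‖v1 - v2‖ ^ 2))
    (hFv : ∀ v, ‖v - v0‖ ≤ Real.sqrt (2 * F u0 v0) →
      |F ustar v - F ustar v0| ≤ Dn * ‖ustar‖ * ‖v - v0‖)
    (tn : ℕ) (htn : Ln ≤ (tn : ℝ))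
    (u : ℕ → EuclideanSpace ℝ (Fin d1)) (v : ℕ → EuclideanSpace ℝ (Fin d2))
    (hu0 : u 0 = u0) (hv0 : v 0 = v0)
    (hu : ∀ t < tn, u (t + 1) = u t - (tn : ℝ)⁻¹ • gradU F (u t) (v t))
    (hv : ∀ t < tn, v (t + 1) = v t - (tn : ℝ)⁻¹ • gradV F (u t) (v t)) :
    F (u tn) (v tn)
      ≤ F ustar v0 + Dn * ‖ustar‖ * Real.sqrt (2 * F u0 v0)
        + ‖ustar - u0‖ ^ 2 / 2 + F u0 v0 / tn := by
  have htp : (0:ℝ) < tn := hLn.trans_le htn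
  have hip : 0 < (tn:ℝ)⁻¹ := inv_pos.2 htp
  have hdF : ∀ a b, HasFDerivAt (fun p : EuclideanSpace ℝ (Fin d1) × EuclideanSpace ℝ (Fin d2) =>
      F p.1 p.2) (fderiv ℝ (fun p : EuclideanSpace ℝ (Fin d1) × EuclideanSpace ℝ (Fin d2) =>
      F p.1 p.2) (a, b)) (a, b) := fun a b =>
    (hFsmooth.differentiable one_ne_zero (a, b)).hasFDerivAt
  have hdu : ∀ a b, HasFDerivAt (fun a' => F a' b)
      ((fderiv ℝ (fun p : EuclideanSpace ℝ (Fin d1) × EuclideanSpace ℝ (Fin d2) =>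
      F p.1 p.2) (a, b)).comp (ContinuousLinearMap.inl ℝ _ _)) a := fun a b =>
    HasFDerivAt.comp (g := fun p : EuclideanSpace ℝ (Fin d1) × EuclideanSpace ℝ (Fin d2) =>
      F p.1 p.2) (f := fun e => (e, b)) a (hdF a b) (hasFDerivAt_prodMk_left (𝕜 := ℝ) a b)
  have hdv : ∀ a b, HasFDerivAt (F a)
      ((fderiv ℝ (fun p : EuclideanSpace ℝ (Fin d1) × EuclideanSpace ℝ (Fin d2) =>
      F p.1 p.2) (a, b)).comp (ContinuousLinearMap.inr ℝ _ _)) b := fun a b =>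
    HasFDerivAt.comp (g := fun p : EuclideanSpace ℝ (Fin d1) × EuclideanSpace ℝ (Fin d2) =>
      F p.1 p.2) (f := fun e => (a, e)) b (hdF a b) (hasFDerivAt_prodMk_right (𝕜 := ℝ) a b)
  let f : WithLp 2 (EuclideanSpace ℝ (Fin d1) × EuclideanSpace ℝ (Fin d2)) → ℝ :=
    fun x => F x.fst x.snd
  let G : WithLp 2 (EuclideanSpace ℝ (Fin d1) × EuclideanSpace ℝ (Fin d2)) →
      WithLp 2 (EuclideanSpace ℝ (Fin d1) × EuclideanSpace ℝ (Fin d2)) :=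
    fun x => WithLp.toLp 2 (gradU F x.fst x.snd, gradV F x.fst x.snd)
  let X : ℕ → WithLp 2 (EuclideanSpace ℝ (Fin d1) × EuclideanSpace ℝ (Fin d2)) :=
    fun k => WithLp.toLp 2 (u k, v k)
  have hfX0 : f (X 0) = F u0 v0 := by simp [f, X, hu0, hv0]
  have hfG : ∀ x, HasFDerivAt f (innerSL ℝ (G x)) x := by
    intro x
    have h1 := HasFDerivAt.comp
      (g := fun p : EuclideanSpace ℝ (Fin d1) × EuclideanSpace ℝ (Fin d2) => F p.1 p.2)
      x (hdF x.fst x.snd)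
      (WithLp.prodContinuousLinearEquiv 2 ℝ (EuclideanSpace ℝ (Fin d1))
        (EuclideanSpace ℝ (Fin d2))).hasFDerivAt
    refine h1.congr_fderiv ?_
    ext y
    have e1 : inner ℝ (gradU F x.fst x.snd) y.fst = _ :=
      congrArg (fun T => T y.fst)
        ((hdu x.fst x.snd).differentiableAt.hasGradientAt.hasFDerivAt.unique (hdu x.fst x.snd))
    have e2 : inner ℝ (gradV F x.fst x.snd) y.snd = _ :=
      congrArg (fun T => T y.snd)
        ((hdv x.fst x.snd).differentiableAt.hasGradientAt.hasFDerivAt.unique (hdv x.fst x.snd))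
    simp only [innerSL_apply_apply, WithLp.prod_inner_apply, G]
    refine Eq.trans ?_ (congrArg₂ (· + ·) e1 e2).symm
    simp only [ContinuousLinearMap.comp_apply]
    rw [← map_add]
    congr 1
    ext <;> simp
  have key := gd_generic f G hfG (fun x => hF0 _ _) Ln hLn tn htn X
    (by
      intro x hx
      rw [hfX0, WithLp.prod_norm_eq_of_L2] at hx
      rw [WithLp.prod_norm_eq_of_L2]
      exact hgradbound _ _ (by simpa [X, hu0, hv0] using hx))
    (by
      intro x y hx hy
      rw [hfX0, WithLp.prod_norm_eq_of_L2] at hx hy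
      rw [WithLp.prod_norm_eq_of_L2, WithLp.prod_norm_eq_of_L2]
      exact hgradlip _ _ _ _ (by simpa [X, hu0, hv0] using hx) (by simpa [X, hu0, hv0] using hy))
    (by
      intro k hk
      simp only [X, G, hu k hk, hv k hk]
      rfl)
  have hvk : ∀ k ≤ tn, F ustar (v k) ≤ F ustar v0 + Dn * ‖ustar‖ * √(2 * F u0 v0) := by
    intro k hk
    have h1 := (key k hk).1
    rw [hfX0, WithLp.prod_norm_eq_of_L2] at h1
    have h2 : ‖v k - v0‖ ≤ √(2 * F u0 v0) := by
      refine le_trans ?_ h1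
      apply Real.le_sqrt_of_sq_le
      simp [X, hv0]
    have h3 := (le_abs_self _).trans (hFv (v k) h2)
    have h4 : Dn * ‖ustar‖ * ‖v k - v0‖ ≤ Dn * ‖ustar‖ * √(2 * F u0 v0) := by gcongr
    linarith
  have hstep : ∀ k < tn, (tn:ℝ)⁻¹ * F (u tn) (v tn) ≤
      (tn:ℝ)⁻¹ * (F ustar v0 + Dn * ‖ustar‖ * √(2 * F u0 v0))
      + (‖u k - ustar‖ ^ 2 - ‖u (k+1) - ustar‖ ^ 2) / 2
      + (tn:ℝ)⁻¹ * ((tn:ℝ)⁻¹ / 2 * ‖G (X k)‖ ^ 2) := by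
    intro k hk
    have h1 : F (u tn) (v tn) ≤ F (u k) (v k) := (key tn le_rfl).2.2 k hk
    have h2 : F (u k) (v k) - F ustar (v k) ≤ inner ℝ (gradU F (u k) (v k)) (u k - ustar) :=
      gd_convex (fun a => F a (v k)) (hconv _) (u k) ustar (hdu _ _).differentiableAt
    have h3 := hvk k hk.le
    have h4 : ‖gradU F (u k) (v k)‖ ^ 2 ≤ ‖G (X k)‖ ^ 2 := by
      rw [WithLp.prod_norm_sq_eq_of_L2]
      simp [G, X]
    have h5 : ‖u (k+1) - ustar‖ ^ 2 = ‖u k - ustar‖ ^ 2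
        - 2 * ((tn:ℝ)⁻¹ * inner ℝ (gradU F (u k) (v k)) (u k - ustar))
        + (tn:ℝ)⁻¹ ^ 2 * ‖gradU F (u k) (v k)‖ ^ 2 := by
      rw [hu k hk, sub_right_comm, norm_sub_sq_real, real_inner_smul_right, real_inner_comm,
        norm_smul, Real.norm_of_nonneg hip.le, mul_pow]
    have h6 : (tn:ℝ)⁻¹ ^ 2 * ‖gradU F (u k) (v k)‖ ^ 2 ≤ (tn:ℝ)⁻¹ ^ 2 * ‖G (X k)‖ ^ 2 := by
      gcongr
    have h7 : F (u tn) (v tn) ≤ (F ustar v0 + Dn * ‖ustar‖ * √(2 * F u0 v0))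
        + inner ℝ (gradU F (u k) (v k)) (u k - ustar) := by linarith
    have h8 := mul_le_mul_of_nonneg_left h7 hip.le
    rw [mul_add] at h8
    linarith
  have hsum := Finset.sum_le_sum (fun k hk => hstep k (Finset.mem_range.1 hk))
  rw [Finset.sum_add_distrib, Finset.sum_add_distrib, ← Finset.sum_div, Finset.sum_range_sub',
    Finset.sum_const, Finset.sum_const, Finset.card_range,
    nsmul_eq_mul, nsmul_eq_mul, ← mul_assoc, ← mul_assoc, mul_inv_cancel₀ htp.ne', one_mul,
    one_mul, ← Finset.mul_sum, ← Finset.mul_sum, hu0, norm_sub_rev u0] at hsum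
  have hk2 := mul_le_mul_of_nonneg_left (key tn le_rfl).2.1 hip.le
  rw [hfX0] at hk2
  have hpos : 0 ≤ (tn:ℝ)⁻¹ * f (X tn) := mul_nonneg hip.le (hF0 _ _)
  have hsq := sq_nonneg ‖u tn - ustar‖
  rw [div_eq_inv_mul (F u0 v0)]
  linarith
end

section
/- Gradient descent stays near the initialization (Lemma 1, second assertion): let d₁, d₂ ∈ ℕ, (u₀,v₀) ∈ ℝ^{d₁}×ℝ^{d₂}, let F : ℝ^{d₁}×ℝ^{d₂} → ℝ₊ be continuously differentiable, and set A = {(u,v) : ‖(u,v) − (u₀,v₀)‖ ≤ 2·√(F(u₀,v₀)) + 1}. Assume ‖(∇F)(u,v)‖ ≤ L_n for all (u,v) ∈ A and ‖(∇F)(u₁,v₁) − (∇F)(u₂,v₂)‖ ≤ L_n·‖(u₁,v₁) − (u₂,v₂)‖ for all (u₁,v₁),(u₂,v₂) ∈ A, for some L_n > 0. Define iterates u_{t+1} = u_t − λ·(∇_u F)(u_t,v_t) and v_{t+1} = v_t − λ·(∇_v F)(u_t,v_t) for t = 0,1,…,t_n−1, where t_n ≥ L_n and λ = 1/t_n. Then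 ‖u_t − u₀‖ ≤ √(2·F(u₀,v₀)) and ‖v_t − v₀‖ ≤ √(2·F(u₀,v₀)) for all t = 0,1,…,t_n. -/
open scoped BigOperators

lemma aux_descent {H : Type*} [NormedAddCommGroup H] [InnerProductSpace ℝ H] [CompleteSpace H]
    (G : H → ℝ) (g : H → H) (hg : ∀ x, HasGradientAt G (g x) x) (x d : H) (L : ℝ)
    (hL : ∀ s : ℝ, 0 ≤ s → s ≤ 1 → ‖g (x + s • d) - g x‖ ≤ L * ‖s • d‖) :
    G (x + d) ≤ G x + inner ℝ (g x) d + L / 2 * ‖d‖ ^ 2 := by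
  have hder : ∀ s : ℝ, HasDerivAt
      (fun s : ℝ => G (x + s • d) - s * inner ℝ (g x) d - L / 2 * ‖d‖ ^ 2 * s ^ 2)
      (inner ℝ (g (x + s • d)) d - inner ℝ (g x) d - L * ‖d‖ ^ 2 * s) s := by
    intro s
    have h1 : HasDerivAt (fun s : ℝ => x + s • d) d s := by
      simpa using ((hasDerivAt_id s).smul_const d).const_add x
    have h2 := (hg (x + s • d)).hasFDerivAt.comp_hasDerivAt s h1
    have h3 := (h2.sub ((hasDerivAt_id s).mul_const (inner ℝ (g x) d))).sub
      ((hasDerivAt_pow 2 s).const_mul (L / 2 * ‖d‖ ^ 2))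
    refine HasDerivAt.congr_deriv h3 ?_
    simp
    ring
  have hanti : AntitoneOn
      (fun s : ℝ => G (x + s • d) - s * inner ℝ (g x) d - L / 2 * ‖d‖ ^ 2 * s ^ 2)
      (Set.Icc 0 1) := by
    apply antitoneOn_of_deriv_nonpos (convex_Icc 0 1)
    · exact fun s _ => (hder s).continuousAt.continuousWithinAt
    · exact fun s _ => (hder s).differentiableAt.differentiableWithinAt
    · intro s hs
      rw [interior_Icc] at hs
      rw [(hder s).deriv, ← inner_sub_left]
      have h1 := real_inner_le_norm (g (x + s • d) - g x) d
      have h2 := hL s hs.1.le hs.2.le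
      rw [norm_smul, Real.norm_of_nonneg hs.1.le] at h2
      have h3 := mul_le_mul_of_nonneg_right h2 (norm_nonneg d)
      nlinarith
  have h := hanti (Set.left_mem_Icc.2 zero_le_one) (Set.right_mem_Icc.2 zero_le_one) zero_le_one
  simp at h
  linarith

lemma aux_gd {H : Type*} [NormedAddCommGroup H] [InnerProductSpace ℝ H] [CompleteSpace H]
    (G : H → ℝ) (g : H → H) (hg : ∀ x, HasGradientAt G (g x) x) (hG : ∀ x, 0 ≤ G x)
    (w0 : H) (L : ℝ) (hL : 0 < L)
    (hb : ∀ x, ‖x - w0‖ ≤ 2 * √(G w0) + 1 → ‖g x‖ ≤ L)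
    (hl : ∀ x y, ‖x - w0‖ ≤ 2 * √(G w0) + 1 → ‖y - w0‖ ≤ 2 * √(G w0) + 1 →
      ‖g x - g y‖ ≤ L * ‖x - y‖)
    (n : ℕ) (hn : L ≤ n) (w : ℕ → H) (h0 : w 0 = w0)
    (hw : ∀ t < n, w (t + 1) = w t - (n : ℝ)⁻¹ • g (w t)) :
    ∀ t ≤ n, ‖w t - w0‖ ≤ √(2 * G w0) := by
  have hnpos : (0 : ℝ) < n := hL.trans_le hn
  set r : ℝ := (n : ℝ)⁻¹ with hr
  have hrpos : 0 < r := inv_pos.2 hnpos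
  have hrn : r * n = 1 := inv_mul_cancel₀ hnpos.ne'
  have hrL : r * L ≤ 1 := by nlinarith
  have fin : ∀ t ≤ n, G (w t) ≤ G w0 →
      ‖w t - w0‖ ^ 2 ≤ (t * r) * (2 * (G w0 - G (w t))) → ‖w t - w0‖ ≤ √(2 * G w0) := by
    intro t ht h1 h2
    apply Real.le_sqrt_of_sq_le
    have h3 : (t : ℝ) * r ≤ 1 := by
      have : (t : ℝ) ≤ n := by exact_mod_cast ht
      nlinarith
    have h4 := hG (w t)
    nlinarith [mul_nonneg (sub_nonneg.2 h3) (sub_nonneg.2 h1)]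
  have inv : ∀ t ≤ n, G (w t) ≤ G w0 ∧
      ‖w t - w0‖ ^ 2 ≤ (t * r) * (2 * (G w0 - G (w t))) := by
    intro t
    induction t with
    | zero => intro _; simp [h0]
    | succ t ih =>
      intro ht
      obtain ⟨i1, i2⟩ := ih (by omega)
      have hd := fin t (by omega) i1 i2
      have hs2 : √(2 * G w0) ≤ 2 * √(G w0) := by
        rw [Real.sqrt_le_left (by positivity), mul_pow, Real.sq_sqrt (hG w0)]
        linarith [hG w0]
      have hA : ‖w t - w0‖ ≤ 2 * √(G w0) + 1 := by linarith
      have hgb := hb _ hA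
      have hstep := hw t (by omega)
      set d : H := -(r • g (w t)) with hdd
      have hnd : ‖d‖ = r * ‖g (w t)‖ := by
        rw [hdd, norm_neg, norm_smul, Real.norm_of_nonneg hrpos.le]
      have hnd1 : ‖d‖ ≤ 1 := by
        rw [hnd]; nlinarith
      have hstep' : w (t + 1) = w t + d := by rw [hstep, hdd, sub_eq_add_neg]
      have key := aux_descent G g hg (w t) d L (by
        intro s hs0 hs1
        have : ‖w t + s • d - w0‖ ≤ 2 * √(G w0) + 1 := by
          have e : w t + s • d - w0 = (w t - w0) + s • d := by abel
          rw [e]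
          have := norm_add_le (w t - w0) (s • d)
          have h5 : ‖s • d‖ ≤ 1 := by
            rw [norm_smul, Real.norm_of_nonneg hs0]
            nlinarith [norm_nonneg d]
          linarith
        simpa using hl _ _ this hA)
      rw [← hstep'] at key
      have hin : inner ℝ (g (w t)) d = - (r * ‖g (w t)‖ ^ 2) := by
        rw [hdd, inner_neg_right, real_inner_smul_right, real_inner_self_eq_norm_sq]
      rw [hin, hnd] at key
      have hY : r * ‖g (w t)‖ ^ 2 ≤ 2 * (G (w t) - G (w (t + 1))) := by
        have : r * L * (r * ‖g (w t)‖ ^ 2) ≤ 1 * (r * ‖g (w t)‖ ^ 2) :=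
          mul_le_mul_of_nonneg_right hrL (by positivity)
        nlinarith
      have hYp : 0 ≤ r * ‖g (w t)‖ ^ 2 := by positivity
      refine ⟨by linarith, ?_⟩
      have htri : ‖w (t + 1) - w0‖ ≤ ‖w t - w0‖ + ‖d‖ := by
        have e : w (t + 1) - w0 = (w t - w0) + d := by rw [hstep']; abel
        rw [e]; exact norm_add_le _ _
      have hb2 : ‖d‖ ^ 2 ≤ r * (2 * (G (w t) - G (w (t + 1)))) := by
        rw [hnd]; nlinarith
      set a := ‖w t - w0‖
      set b := ‖d‖
      have ha0 : 0 ≤ a := norm_nonneg _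
      have hb0 : 0 ≤ b := norm_nonneg _
      obtain ⟨X, hX⟩ : ∃ X, X = 2 * (G w0 - G (w t)) := ⟨_, rfl⟩
      obtain ⟨Y, hYe⟩ : ∃ Y, Y = 2 * (G (w t) - G (w (t + 1))) := ⟨_, rfl⟩
      have e : 2 * (G w0 - G (w (t + 1))) = X + Y := by rw [hX, hYe]; ring
      rw [e]
      rw [← hX] at i2
      rw [← hYe] at hb2
      have hX0 : 0 ≤ X := by rw [hX]; linarith
      have hY0 : 0 ≤ Y := by rw [hYe]; linarith
      have ht0 : (0 : ℝ) ≤ t := Nat.cast_nonneg t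
      have hab : 2 * (a * b) ≤ t * r * Y + r * X := by
        refine abs_le_of_sq_le_sq' ?_ (by positivity) |>.2
        have h6 : a ^ 2 * b ^ 2 ≤ (t * r * X) * (r * Y) :=
          mul_le_mul i2 hb2 (by positivity) (by positivity)
        nlinarith [sq_nonneg (t * r * Y - r * X)]
      have h7 : ‖w (t + 1) - w0‖ ^ 2 ≤ (a + b) ^ 2 :=
        pow_le_pow_left₀ (norm_nonneg _) htri 2
      push_cast
      nlinarith
  exact fun t ht => fin t ht (inv t ht).1 (inv t ht).2

/-- Lemma 1 (second assertion): the gradient descent iterates with step size `λ = 1/t_n`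
stay within distance `√(2·F(u₀,v₀))` of the initialization, provided the (joint) gradient
of the nonnegative continuously differentiable function `F` is bounded by `L_n` and
`L_n`-Lipschitz on the ball `A` of radius `2·√F(u₀,v₀)+1` around `(u₀,v₀)`, and `t_n ≥ L_n`.
Here `‖(u,v)‖ = √(‖u‖²+‖v‖²)` and `∇F = (∇_u F, ∇_v F)`. -/
theorem gradient_descent_stays_near_initialization
    (d1 d2 : ℕ)
    (F : EuclideanSpace ℝ (Fin d1) → EuclideanSpace ℝ (Fin d2) → ℝ)
    (hF0 : ∀ u v, 0 ≤ F u v)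
    (hFsmooth : ContDiff ℝ 1
      (fun p : EuclideanSpace ℝ (Fin d1) × EuclideanSpace ℝ (Fin d2) => F p.1 p.2))
    (u0 : EuclideanSpace ℝ (Fin d1)) (v0 : EuclideanSpace ℝ (Fin d2))
    (Ln : ℝ) (hLn : 0 < Ln)
    (hgradbound : ∀ u v,
      Real.sqrt (‖u - u0‖ ^ 2 + ‖v - v0‖ ^ 2) ≤ 2 * Real.sqrt (F u0 v0) + 1 →
      Real.sqrt (‖gradU F u v‖ ^ 2 + ‖gradV F u v‖ ^ 2) ≤ Ln)
    (hgradlip : ∀ u1 v1 u2 v2,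
      Real.sqrt (‖u1 - u0‖ ^ 2 + ‖v1 - v0‖ ^ 2) ≤ 2 * Real.sqrt (F u0 v0) + 1 →
      Real.sqrt (‖u2 - u0‖ ^ 2 + ‖v2 - v0‖ ^ 2) ≤ 2 * Real.sqrt (F u0 v0) + 1 →
      Real.sqrt (‖gradU F u1 v1 - gradU F u2 v2‖ ^ 2 + ‖gradV F u1 v1 - gradV F u2 v2‖ ^ 2)
        ≤ Ln * Real.sqrt (‖u1 - u2‖ ^ 2 + ‖v1 - v2‖ ^ 2))
    (tn : ℕ) (htn : Ln ≤ (tn : ℝ))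
    (u : ℕ → EuclideanSpace ℝ (Fin d1)) (v : ℕ → EuclideanSpace ℝ (Fin d2))
    (hu0 : u 0 = u0) (hv0 : v 0 = v0)
    (hu : ∀ t < tn, u (t + 1) = u t - (tn : ℝ)⁻¹ • gradU F (u t) (v t))
    (hv : ∀ t < tn, v (t + 1) = v t - (tn : ℝ)⁻¹ • gradV F (u t) (v t)) :
    ∀ t ≤ tn, ‖u t - u0‖ ≤ Real.sqrt (2 * F u0 v0) ∧ ‖v t - v0‖ ≤ Real.sqrt (2 * F u0 v0) := by
  have hgrad : ∀ x : WithLp 2 (EuclideanSpace ℝ (Fin d1) × EuclideanSpace ℝ (Fin d2)),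
      HasGradientAt (fun p : WithLp 2 (EuclideanSpace ℝ (Fin d1) × EuclideanSpace ℝ (Fin d2)) =>
        F p.fst p.snd) (WithLp.toLp 2 (gradU F x.fst x.snd, gradV F x.fst x.snd)) x := by
    intro x
    have hd := (hFsmooth.differentiable one_ne_zero (x.fst, x.snd)).hasFDerivAt
    set D := fderiv ℝ (fun p : EuclideanSpace ℝ (Fin d1) × EuclideanSpace ℝ (Fin d2) =>
      F p.1 p.2) (x.fst, x.snd) with hD
    have hU : HasFDerivAt (fun u' => F u' x.snd) (D.comp (ContinuousLinearMap.inl ℝ _ _)) x.fst :=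
      HasFDerivAt.comp (f := fun u' => (u', x.snd)) x.fst hd (hasFDerivAt_prodMk_left x.fst x.snd)
    have hV : HasFDerivAt (F x.fst) (D.comp (ContinuousLinearMap.inr ℝ _ _)) x.snd :=
      HasFDerivAt.comp (f := fun v' => (x.fst, v')) x.snd hd (hasFDerivAt_prodMk_right x.fst x.snd)
    have hU' := hU.unique hU.differentiableAt.hasGradientAt.hasFDerivAt
    have hV' := hV.unique hV.differentiableAt.hasGradientAt.hasFDerivAt
    have hc := HasFDerivAt.comp x (g := fun p : EuclideanSpace ℝ (Fin d1) ×
        EuclideanSpace ℝ (Fin d2) => F p.1 p.2) hd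
      (WithLp.prodContinuousLinearEquiv 2 ℝ (EuclideanSpace ℝ (Fin d1))
        (EuclideanSpace ℝ (Fin d2))).hasFDerivAt
    rw [hasGradientAt_iff_hasFDerivAt]
    refine HasFDerivAt.congr_fderiv hc ?_
    ext y
    have e1 := congrArg (fun T => T y.fst) hU'
    have e2 := congrArg (fun T => T y.snd) hV'
    simp at e1 e2
    have e3 : D (y.fst, y.snd) = D (y.fst, 0) + D (0, y.snd) := by
      rw [← map_add]; simp
    simp [WithLp.prod_inner_apply]
    change D (y.fst, y.snd) = _
    rw [e3, e1, e2]
    simp [gradU, gradV]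
  have main := aux_gd _ _ hgrad (fun x => hF0 _ _) (WithLp.toLp 2 (u0, v0)) Ln hLn
    (by
      intro x hx
      rw [WithLp.prod_norm_eq_of_L2] at hx ⊢
      exact hgradbound _ _ hx)
    (by
      intro x y hx hy
      rw [WithLp.prod_norm_eq_of_L2] at hx hy ⊢
      rw [WithLp.prod_norm_eq_of_L2]
      exact hgradlip _ _ _ _ hx hy)
    tn htn (fun t => WithLp.toLp 2 (u t, v t)) (by simp [hu0, hv0])
    (by
      intro t ht
      simp only [hu t ht, hv t ht]
      rfl)
  intro t ht
  have h := main t ht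
  rw [WithLp.prod_norm_eq_of_L2] at h
  change √(‖u t - u0‖ ^ 2 + ‖v t - v0‖ ^ 2) ≤ √(2 * F u0 v0) at h
  exact ⟨(Real.le_sqrt_of_sq_le (by nlinarith [sq_nonneg ‖v t - v0‖])).trans h,
    (Real.le_sqrt_of_sq_le (by nlinarith [sq_nonneg ‖u t - u0‖])).trans h⟩
end

section
/- Bound on the gradient of the empirical L₂ risk (Lemma 2): let σ : ℝ → ℝ be bounded and differentiable with bounded derivative. Let α_n ≥ 1, t_n ≥ L_n > 0, γ_n* ≥ 1, B_n ≥ 1, r ≥ 2d, and let w, v be weight vectors with |w^{(L)}_{1,1,k}| ≤ γ_n* for k = 1,…,K_n, |w^{(l)}_{k,i,j}| ≤ B_n for l = 1,…,L−1, and ‖w − v‖_∞² ≤ (8·t_n/L_n)·max{F_n(v), 1}. Then for X_1,…,X_n ∈ [−α_n, α_n]^d there is a constant c₇ (depending only on d, L, r and σ) with ‖(∇_w F_n)(w)‖ ≤ c₇·K_n^{3/2}·B_n^{2L}·(γ_n*)²·α_n²·√((t_n/L_n)·max{F_n(v), 1}). -/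
open scoped BigOperators

/-- Index type for the weights of a linear combination of `K` fully connected networks
with `L` layers, `r` neurons per layer and input dimension `d`:
`out k` is the output weight `w^{(L)}_{1,1,k}` (paper index `k+1`),
`inner l k i j` is the weight `w^{(l+1)}_{k+1,i+1,j}` (layers `1,…,L-1`, `j = 0` the bias),
`input k i j` is the weight `w^{(0)}_{k+1,i+1,j}` (`j = 0` the bias). -/
inductive NNIdx (K L r d : ℕ) : Type where
  | out (k : Fin K)
  | inner (l : Fin (L - 1)) (k : Fin K) (i : Fin r) (j : Fin (r + 1))
  | input (k : Fin K) (i : Fin r) (j : Fin (d + 1))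
  deriving DecidableEq, Fintype

/-- `nOut σ K L r d w k l i x` is the output `f^{(l)}_{k+1,i+1}(x)` of neuron `i+1`
in layer `l` of the `k+1`-st fully connected network with weights `w` and activation `σ`. -/
noncomputable def nOut (σ : ℝ → ℝ) (K L r d : ℕ) (w : NNIdx K L r d → ℝ) (k : Fin K) :
    ℕ → Fin r → (Fin d → ℝ) → ℝ
  | 0, _, _ => 0
  | 1, i, x => σ ((∑ j : Fin d, w (NNIdx.input k i j.succ) * x j) + w (NNIdx.input k i 0))
  | l + 2, i, x =>
    if h : l < L - 1 then
      σ ((∑ j : Fin r, w (NNIdx.inner ⟨l, h⟩ k i j.succ) * nOut σ K L r d w k (l + 1) j x)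
        + w (NNIdx.inner ⟨l, h⟩ k i 0))
    else 0

/-- The network `f_w(x) = ∑_{k=1}^{K} w^{(L)}_{1,1,k}·f^{(L)}_{k,1}(x)`. -/
noncomputable def fnet (σ : ℝ → ℝ) (K L r d : ℕ) (w : NNIdx K L r d → ℝ) (x : Fin d → ℝ) : ℝ :=
  if h : 0 < r then ∑ k : Fin K, w (NNIdx.out k) * nOut σ K L r d w k L ⟨0, h⟩ x else 0

/-- The empirical L₂ risk `F_n(w) = (1/n)·∑_{i=1}^n |f_w(X_i) - Y_i|²`. -/
noncomputable def empRisk (σ : ℝ → ℝ) (K L r d n : ℕ)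
    (X : Fin n → Fin d → ℝ) (Y : Fin n → ℝ)
    (w : EuclideanSpace ℝ (NNIdx K L r d)) : ℝ :=
  (n : ℝ)⁻¹ * ∑ i : Fin n, (fnet σ K L r d w (X i) - Y i) ^ 2


lemma nOut_bdd (σ : ℝ → ℝ) (K L r d : ℕ) (M : ℝ) (hM : 1 ≤ M) (hσ : ∀ x, |σ x| ≤ M)
    (w : NNIdx K L r d → ℝ) (k : Fin K) (l : ℕ) (i : Fin r) (x : Fin d → ℝ) :
    |nOut σ K L r d w k l i x| ≤ M := by
  have h0 : |(0:ℝ)| ≤ M := by rw [abs_zero]; linarith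
  match l with
  | 0 => rw [nOut]; exact h0
  | 1 => rw [nOut]; exact hσ _
  | l + 2 =>
    rw [nOut]
    split_ifs
    · exact hσ _
    · exact h0

/-- the block an index belongs to -/
def blk {K L r d : ℕ} : NNIdx K L r d → Fin K
  | NNIdx.out k => k
  | NNIdx.inner _ k _ _ => k
  | NNIdx.input k _ _ => k

lemma nOut_lip (σ : ℝ → ℝ) (L r d : ℕ) (M : ℝ) (hM : 1 ≤ M) (hσ : ∀ x, |σ x| ≤ M)
    (hl : ∀ a b, |σ a - σ b| ≤ M * |a - b|) (l : ℕ) :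
    ∃ C : ℝ, 0 ≤ C ∧ ∀ (K : ℕ) (u w : NNIdx K L r d → ℝ) (k : Fin K) (B α δ : ℝ)
      (x : Fin d → ℝ), 1 ≤ B → 1 ≤ α → 0 ≤ δ →
      (∀ l i j, |w (NNIdx.inner l k i j)| ≤ B) → (∀ j, |x j| ≤ α) →
      (∀ idx, blk idx = k → |u idx - w idx| ≤ δ) →
      ∀ i, |nOut σ K L r d u k l i x - nOut σ K L r d w k l i x| ≤ C * B ^ l * α * δ := by
  induction l with
  | zero =>
    refine ⟨0, le_rfl, ?_⟩
    intros
    simp [nOut]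
  | succ l ih =>
    cases l with
    | zero =>
      refine ⟨M * (d + 1), by positivity, ?_⟩
      intro K u w k B α δ x hB hα hδ hw hx hu i
      simp only [nOut, zero_add]
      refine (hl _ _).trans ?_
      have h1 : |(∑ j : Fin d, u (NNIdx.input k i j.succ) * x j) + u (NNIdx.input k i 0)
          - ((∑ j : Fin d, w (NNIdx.input k i j.succ) * x j) + w (NNIdx.input k i 0))|
          ≤ d * (δ * α) + δ := by
        have : (∑ j : Fin d, u (NNIdx.input k i j.succ) * x j) + u (NNIdx.input k i 0)
          - ((∑ j : Fin d, w (NNIdx.input k i j.succ) * x j) + w (NNIdx.input k i 0))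
          = (∑ j : Fin d, (u (NNIdx.input k i j.succ) - w (NNIdx.input k i j.succ)) * x j)
            + (u (NNIdx.input k i 0) - w (NNIdx.input k i 0)) := by
          simp only [sub_mul, Finset.sum_sub_distrib]; ring
        rw [this]
        refine (abs_add_le _ _).trans (add_le_add ?_ (hu _ rfl))
        refine (Finset.abs_sum_le_sum_abs _ _).trans ?_
        have : (d : ℝ) * (δ * α) = ∑ j : Fin d, δ * α := by simp
        rw [this]
        refine Finset.sum_le_sum fun j _ => ?_
        rw [abs_mul]
        exact mul_le_mul (hu _ rfl) (hx j) (abs_nonneg _) hδ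
      calc _ ≤ M * (d * (δ * α) + δ) := by gcongr
        _ ≤ M * (d * (δ * α) + δ * α * 1) := by
            gcongr; nlinarith
        _ = M * (d + 1) * 1 * α * δ := by ring
        _ ≤ M * (d + 1) * B ^ 1 * α * δ := by gcongr; simpa using hB
    | succ l =>
      obtain ⟨C, hC, ih⟩ := ih
      refine ⟨M * (r * (M + C) + 1), by positivity, ?_⟩
      intro K u w k B α δ x hB hα hδ hw hx hu i
      have hd := ih K u w k B α δ x hB hα hδ hw hx hu
      rw [nOut, nOut]
      have hB0 : 0 ≤ B := by linarith
      have hE : 0 ≤ M * (r * (M + C) + 1) * B ^ (l + 1 + 1) * α * δ := by positivity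
      split_ifs with h
      swap
      · simpa using hE
      refine (hl _ _).trans ?_
      have hP : 1 ≤ B ^ (l + 2) * α := one_le_mul_of_one_le_of_one_le (one_le_pow₀ hB) hα
      have h1 : |(∑ j : Fin r, u (NNIdx.inner ⟨l, h⟩ k i j.succ) * nOut σ K L r d u k (l+1) j x)
            + u (NNIdx.inner ⟨l, h⟩ k i 0)
          - ((∑ j : Fin r, w (NNIdx.inner ⟨l, h⟩ k i j.succ) * nOut σ K L r d w k (l+1) j x)
            + w (NNIdx.inner ⟨l, h⟩ k i 0))|
          ≤ r * (δ * M + B * (C * B ^ (l+1) * α * δ)) + δ := by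
        have : (∑ j : Fin r, u (NNIdx.inner ⟨l, h⟩ k i j.succ) * nOut σ K L r d u k (l+1) j x)
            + u (NNIdx.inner ⟨l, h⟩ k i 0)
          - ((∑ j : Fin r, w (NNIdx.inner ⟨l, h⟩ k i j.succ) * nOut σ K L r d w k (l+1) j x)
            + w (NNIdx.inner ⟨l, h⟩ k i 0))
          = (∑ j : Fin r, ((u (NNIdx.inner ⟨l, h⟩ k i j.succ) - w (NNIdx.inner ⟨l, h⟩ k i j.succ))
              * nOut σ K L r d u k (l+1) j x + w (NNIdx.inner ⟨l, h⟩ k i j.succ) *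
              (nOut σ K L r d u k (l+1) j x - nOut σ K L r d w k (l+1) j x)))
            + (u (NNIdx.inner ⟨l, h⟩ k i 0) - w (NNIdx.inner ⟨l, h⟩ k i 0)) := by
          simp only [sub_mul, mul_sub, Finset.sum_sub_distrib, Finset.sum_add_distrib]; ring
        rw [this]
        refine (abs_add_le _ _).trans (add_le_add ?_ (hu _ rfl))
        refine (Finset.abs_sum_le_sum_abs _ _).trans ?_
        have : (r : ℝ) * (δ * M + B * (C * B ^ (l+1) * α * δ))
          = ∑ j : Fin r, (δ * M + B * (C * B ^ (l+1) * α * δ)) := by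
          rw [Finset.sum_const, Finset.card_univ, Fintype.card_fin, nsmul_eq_mul]
        rw [this]
        refine Finset.sum_le_sum fun j _ => ?_
        refine (abs_add_le _ _).trans (add_le_add ?_ ?_)
        · rw [abs_mul]
          exact mul_le_mul (hu _ rfl) (nOut_bdd σ K L r d M hM hσ _ _ _ _ _) (abs_nonneg _) hδ
        · rw [abs_mul]
          exact mul_le_mul (hw _ _ _) (hd j) (abs_nonneg _) hB0
      calc _ ≤ M * (r * (δ * M + B * (C * B ^ (l+1) * α * δ)) + δ) := by gcongr
        _ = M * (r * (δ * M * 1 + C * (B ^ (l+2) * α) * δ) + δ * 1) := by ring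
        _ ≤ M * (r * (δ * M * (B ^ (l+2) * α) + C * (B ^ (l+2) * α) * δ)
              + δ * (B ^ (l+2) * α)) := by gcongr
        _ = _ := by ring

lemma fnet_lip (σ : ℝ → ℝ) (L r d : ℕ) (M : ℝ) (hM : 1 ≤ M) (hσ : ∀ x, |σ x| ≤ M)
    (hl : ∀ a b, |σ a - σ b| ≤ M * |a - b|) :
    ∃ C : ℝ, 0 ≤ C ∧ ∀ (K : ℕ) (u w : EuclideanSpace ℝ (NNIdx K L r d)) (B α γ : ℝ)
      (x : Fin d → ℝ), 1 ≤ B → 1 ≤ α → 1 ≤ γ →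
      (∀ k, |w (NNIdx.out k)| ≤ γ) →
      (∀ l k i j, |w (NNIdx.inner l k i j)| ≤ B) → (∀ j, |x j| ≤ α) →
      |fnet σ K L r d u x - fnet σ K L r d w x|
        ≤ (M + γ * (C * B ^ L * α)) * (Real.sqrt K * ‖u - w‖) := by
  obtain ⟨C, hC, H⟩ := nOut_lip σ L r d M hM hσ hl L
  refine ⟨C, hC, ?_⟩
  intro K u w B α γ x hB hα hγ hwo hwi hx
  have hB0 : 0 ≤ B := by linarith
  have hpos : 0 ≤ M + γ * (C * B ^ L * α) := by positivity
  unfold fnet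
  split_ifs with h
  swap
  · rw [sub_zero, abs_zero]; positivity
  let δ : Fin K → ℝ := fun k => Real.sqrt (∑ idx with blk idx = k, (u idx - w idx) ^ 2)
  have hδ : ∀ k, 0 ≤ δ k := fun k => Real.sqrt_nonneg _
  have hδ2 : ∀ k idx, blk idx = k → |u idx - w idx| ≤ δ k := by
    intro k idx hk
    apply Real.abs_le_sqrt
    exact Finset.single_le_sum (f := fun idx => (u idx - w idx) ^ 2)
      (fun _ _ => sq_nonneg _) (by simp [hk])
  have hsum : ∑ k, δ k ^ 2 = ‖u - w‖ ^ 2 := by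
    rw [EuclideanSpace.real_norm_sq_eq]
    simp only [PiLp.sub_apply]
    rw [← Finset.sum_fiberwise Finset.univ (blk : NNIdx K L r d → Fin K)]
    refine Finset.sum_congr rfl fun k _ => ?_
    exact Real.sq_sqrt (Finset.sum_nonneg fun _ _ => sq_nonneg _)
  have hcs : ∑ k, δ k ≤ Real.sqrt K * ‖u - w‖ := by
    refine le_of_abs_le (abs_le_of_sq_le_sq ?_ (by positivity))
    rw [mul_pow, Real.sq_sqrt (by positivity), ← hsum]
    simpa using sq_sum_le_card_mul_sum_sq (s := (Finset.univ : Finset (Fin K))) (f := δ)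
  calc _ = |∑ k, ((u (NNIdx.out k) - w (NNIdx.out k)) * nOut σ K L r d u k L ⟨0, h⟩ x
        + w (NNIdx.out k) * (nOut σ K L r d u k L ⟨0, h⟩ x - nOut σ K L r d w k L ⟨0, h⟩ x))| := by
        congr 1
        rw [← Finset.sum_sub_distrib]
        refine Finset.sum_congr rfl fun k _ => by ring
    _ ≤ ∑ k, (M + γ * (C * B ^ L * α)) * δ k := by
        refine (Finset.abs_sum_le_sum_abs _ _).trans (Finset.sum_le_sum fun k _ => ?_)
        refine (abs_add_le _ _).trans ?_
        rw [abs_mul, abs_mul, add_mul]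
        refine add_le_add ?_ ?_
        · rw [mul_comm]
          exact mul_le_mul (nOut_bdd σ K L r d M hM hσ _ _ _ _ _) (hδ2 k _ rfl)
            (abs_nonneg _) (by linarith)
        · rw [mul_assoc γ]
          exact mul_le_mul (hwo k) (H K u w k B α (δ k) x hB hα (hδ k) (fun l i j => hwi l k i j)
            hx (hδ2 k) _) (abs_nonneg _) (by linarith)
    _ = (M + γ * (C * B ^ L * α)) * ∑ k, δ k := by rw [Finset.mul_sum]
    _ ≤ _ := by gcongr

lemma fnet_bdd (σ : ℝ → ℝ) (K L r d : ℕ) (M : ℝ) (hM : 1 ≤ M) (hσ : ∀ x, |σ x| ≤ M)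
    (w : NNIdx K L r d → ℝ) (γ : ℝ) (hγ : 0 ≤ γ) (hw : ∀ k, |w (NNIdx.out k)| ≤ γ)
    (x : Fin d → ℝ) : |fnet σ K L r d w x| ≤ K * (γ * M) := by
  unfold fnet
  split_ifs with h
  · refine (Finset.abs_sum_le_sum_abs _ _).trans ?_
    have : (K : ℝ) * (γ * M) = ∑ k : Fin K, γ * M := by simp
    rw [this]
    refine Finset.sum_le_sum fun k _ => ?_
    rw [abs_mul]
    exact mul_le_mul (hw k) (nOut_bdd σ K L r d M hM hσ _ _ _ _ _) (abs_nonneg _) hγ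
  · rw [abs_zero]; positivity

lemma mean_abs_le {n : ℕ} (a : Fin n → ℝ) (S : ℝ) (hS : 0 ≤ S)
    (h : (n : ℝ)⁻¹ * ∑ i, a i ^ 2 ≤ S ^ 2) : (n : ℝ)⁻¹ * ∑ i, |a i| ≤ S := by
  rcases Nat.eq_zero_or_pos n with rfl | hn
  · simpa using hS
  have hn' : (0:ℝ) < n := by exact_mod_cast hn
  refine le_of_abs_le (abs_le_of_sq_le_sq ?_ hS)
  refine le_trans ?_ h
  have := sq_sum_le_card_mul_sum_sq (s := (Finset.univ : Finset (Fin n))) (f := fun i => |a i|)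
  simp only [sq_abs, Finset.card_univ, Fintype.card_fin] at this
  rw [mul_pow]
  calc _ ≤ ((n:ℝ)⁻¹) ^ 2 * (n * ∑ i, a i ^ 2) := by gcongr
    _ = _ := by field_simp

lemma mean_const_le (n : ℕ) (P : ℝ) (hP : 0 ≤ P) : (n : ℝ)⁻¹ * ∑ _i : Fin n, P ≤ P := by
  rcases Nat.eq_zero_or_pos n with rfl | hn
  · simpa using hP
  have hn' : (0:ℝ) < n := by exact_mod_cast hn
  simp
  rw [← mul_assoc, inv_mul_cancel₀ hn'.ne', one_mul]

/-- Lemma 2: bound on the (Euclidean norm of the) gradient of the empirical L₂ risk.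
The constant `c₇` depends only on `d`, `L`, `r` and `σ`.  The hypothesis
`‖w - v‖_∞² ≤ (8·t_n/L_n)·max{F_n(v),1}` is expressed componentwise. -/
theorem gradient_of_empirical_risk_bound
    (d L r : ℕ) (σ : ℝ → ℝ)
    (hσbdd : ∃ M : ℝ, ∀ x, |σ x| ≤ M)
    (hσdiff : Differentiable ℝ σ)
    (hσ'bdd : ∃ M : ℝ, ∀ x, |deriv σ x| ≤ M)
    (hrd : 2 * d ≤ r) :
    ∃ c7 : ℝ, 0 < c7 ∧
      ∀ (K n : ℕ) (X : Fin n → Fin d → ℝ) (Y : Fin n → ℝ)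
        (w v : EuclideanSpace ℝ (NNIdx K L r d))
        (αn Ln γn Bn : ℝ) (tn : ℕ),
        1 ≤ αn → 0 < Ln → Ln ≤ (tn : ℝ) → 1 ≤ γn → 1 ≤ Bn →
        (∀ k : Fin K, |w (NNIdx.out k)| ≤ γn) →
        (∀ (l : Fin (L - 1)) (k : Fin K) (i : Fin r) (j : Fin (r + 1)),
          |w (NNIdx.inner l k i j)| ≤ Bn) →
        (∀ idx : NNIdx K L r d,
          |w idx - v idx| ^ 2 ≤ 8 * (tn : ℝ) / Ln * max (empRisk σ K L r d n X Y v) 1) →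
        (∀ (i : Fin n) (j : Fin d), |X i j| ≤ αn) →
        ‖gradient (empRisk σ K L r d n X Y) w‖
          ≤ c7 * (K : ℝ) ^ ((3 : ℝ) / 2) * Bn ^ (2 * L) * γn ^ 2 * αn ^ 2
            * Real.sqrt ((tn : ℝ) / Ln * max (empRisk σ K L r d n X Y v) 1) := by
  obtain ⟨M1, hM1⟩ := hσbdd
  obtain ⟨M2, hM2⟩ := hσ'bdd
  let M := max 1 (max M1 M2)
  have hM : 1 ≤ M := le_max_left _ _
  have hσ : ∀ x, |σ x| ≤ M := fun x =>
    (hM1 x).trans ((le_max_left _ _).trans (le_max_right _ _))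
  have hσ' : ∀ x, |deriv σ x| ≤ M := fun x =>
    (hM2 x).trans ((le_max_right _ _).trans (le_max_right _ _))
  have hl : ∀ a b, |σ a - σ b| ≤ M * |a - b| := by
    intro a b
    have := Convex.norm_image_sub_le_of_norm_deriv_le (f := σ) (C := M) (s := Set.univ)
      (x := b) (y := a)
      (fun x _ => hσdiff x) (fun x _ => hσ' x) convex_univ trivial trivial
    simpa [Real.norm_eq_abs] using this
  clear_value M
  obtain ⟨C, hC, HL⟩ := fnet_lip σ L r d M hM hσ hl
  refine ⟨13 * M ^ 2 * (1 + C), by positivity, ?_⟩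
  intro K n X Y w v α Ln γ B tn hα hLn hLt hγ hB hwo hwi hwv hX
  have hα0 : 0 ≤ α := by linarith
  have hγ0 : 0 ≤ γ := by linarith
  have hB0 : 0 ≤ B := by linarith
  rcases Nat.eq_zero_or_pos K with rfl | hK
  · have : IsEmpty (NNIdx 0 L r d) := ⟨fun i => (blk i).elim0⟩
    have h0 : gradient (empRisk σ 0 L r d n X Y) w = 0 := Subsingleton.elim _ _
    rw [h0, norm_zero]
    positivity
  have hK1 : (1:ℝ) ≤ K := by exact_mod_cast hK
  set m := max (empRisk σ K L r d n X Y v) 1 with hm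
  have hm1 : 1 ≤ m := le_max_right _ _
  set S := Real.sqrt ((tn : ℝ) / Ln * m) with hSdef
  have htL : 1 ≤ (tn : ℝ) / Ln := (one_le_div hLn).2 hLt
  have hSS : S ^ 2 = (tn : ℝ) / Ln * m := Real.sq_sqrt (by positivity)
  have hS0 : 0 ≤ S := Real.sqrt_nonneg _
  have hS1 : 1 ≤ S := by
    rw [hSdef]; exact Real.one_le_sqrt.2 (one_le_mul_of_one_le_of_one_le htL hm1)
  have hFv : empRisk σ K L r d n X Y v ≤ S ^ 2 := by
    rw [hSS]; exact (le_max_left _ _).trans (le_mul_of_one_le_left (by linarith) htL)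
  have hD : ∀ idx, |w idx - v idx| ≤ 3 * S := by
    intro idx
    refine le_of_abs_le (abs_le_of_sq_le_sq ?_ (by positivity))
    refine (hwv idx).trans ?_
    have : 8 * (tn:ℝ) / Ln * m = 8 * S ^ 2 := by rw [hSS]; ring
    rw [this]; nlinarith
  have hvo : ∀ k, |v (NNIdx.out k)| ≤ γ + 3 * S := by
    intro k
    have h1 := hwo k
    have h2 := hD (NNIdx.out k)
    have h3 := abs_sub_abs_le_abs_sub (v (NNIdx.out k)) (w (NNIdx.out k))
    rw [abs_sub_comm] at h3
    linarith
  have hγS : γ + 3 * S ≤ 4 * (γ * S) := by nlinarith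
  have hγS' : γ ≤ γ * S := le_mul_of_one_le_right hγ0 hS1
  let P : ℝ := 5 * (K * γ * S * M)
  have hKM : 0 ≤ K * M := by positivity
  have hA : (n : ℝ)⁻¹ * ∑ i, |fnet σ K L r d w (X i) - Y i| ≤ 6 * (K * γ * S * M) := by
    have hT := mean_abs_le (fun i => fnet σ K L r d v (X i) - Y i) S hS0 hFv
    have hc := mean_const_le n P (by positivity)
    calc _ ≤ (n : ℝ)⁻¹ * ∑ i, (|fnet σ K L r d v (X i) - Y i| + P) := by
          gcongr with i _
          have h1 := fnet_bdd σ K L r d M hM hσ w γ hγ0 hwo (X i)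
          have h2 := fnet_bdd σ K L r d M hM hσ v (γ + 3 * S) (by positivity) hvo (X i)
          have h3 : K * (γ * M) + K * ((γ + 3 * S) * M) ≤ P := by
            have := mul_le_mul_of_nonneg_left (add_le_add hγS' hγS) hKM
            simp only [P]; linarith
          have h4 : fnet σ K L r d w (X i) - Y i = (fnet σ K L r d v (X i) - Y i) +
            (fnet σ K L r d w (X i) - fnet σ K L r d v (X i)) := by ring
          rw [h4]
          refine (abs_add_le _ _).trans (add_le_add le_rfl ?_)
          exact (abs_sub _ _).trans ((add_le_add h1 h2).trans h3)
      _ = (n : ℝ)⁻¹ * ∑ i, |fnet σ K L r d v (X i) - Y i| + (n : ℝ)⁻¹ * ∑ i : Fin n, P := by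
          rw [Finset.sum_add_distrib, mul_add]
      _ ≤ S + P := add_le_add hT hc
      _ ≤ _ := by
          have : 1 * S ≤ (K * γ * M) * S := by
            gcongr
            exact one_le_mul_of_one_le_of_one_le (one_le_mul_of_one_le_of_one_le hK1 hγ) hM
          simp only [P]; linarith
  have hQ1 : 1 ≤ K * γ * S * M :=
    one_le_mul_of_one_le_of_one_le (one_le_mul_of_one_le_of_one_le
      (one_le_mul_of_one_le_of_one_le hK1 hγ) hS1) hM
  set Q := K * γ * S * M with hQ
  let G : ℝ := (M + γ * (C * B ^ L * α)) * Real.sqrt K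
  have hG : 0 ≤ G := by positivity
  have hlip : ∀ u : EuclideanSpace ℝ (NNIdx K L r d), ∀ i,
      |fnet σ K L r d u (X i) - fnet σ K L r d w (X i)| ≤ G * ‖u - w‖ := by
    intro u i
    have := HL K u w B α γ (X i) hB hα hγ hwo hwi (hX i)
    simpa only [G, mul_assoc] using this
  have key : ‖fderiv ℝ (empRisk σ K L r d n X Y) w‖ ≤ G * (13 * Q) := by
    apply norm_fderiv_le_of_lip' ℝ (by positivity)
    have hev : ∀ᶠ u in nhds w, G * ‖u - w‖ < 1 := by
      have : Continuous fun u : EuclideanSpace ℝ (NNIdx K L r d) => G * ‖u - w‖ := by fun_prop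
      exact this.continuousAt.eventually_lt continuousAt_const (by simp)
    filter_upwards [hev] with u hu
    set e := G * ‖u - w‖ with he
    have he0 : 0 ≤ e := by positivity
    have h1 : empRisk σ K L r d n X Y u - empRisk σ K L r d n X Y w
      = (n:ℝ)⁻¹ * ∑ i, ((fnet σ K L r d u (X i) - Y i) ^ 2
          - (fnet σ K L r d w (X i) - Y i) ^ 2) := by
      unfold empRisk
      rw [Finset.sum_sub_distrib, mul_sub]
    rw [h1, Real.norm_eq_abs, abs_mul, abs_of_nonneg (by positivity : (0:ℝ) ≤ (n:ℝ)⁻¹)]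
    calc _ ≤ (n:ℝ)⁻¹ * ∑ i, (e + 2 * e * |fnet σ K L r d w (X i) - Y i|) := by
          gcongr
          refine (Finset.abs_sum_le_sum_abs _ _).trans (Finset.sum_le_sum fun i _ => ?_)
          have hi := hlip u i
          have h4 : (fnet σ K L r d u (X i) - Y i) ^ 2 - (fnet σ K L r d w (X i) - Y i) ^ 2
            = (fnet σ K L r d u (X i) - fnet σ K L r d w (X i)) *
              ((fnet σ K L r d u (X i) - fnet σ K L r d w (X i))
                + 2 * (fnet σ K L r d w (X i) - Y i)) := by ring
          rw [h4, abs_mul]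
          have h5 : |(fnet σ K L r d u (X i) - fnet σ K L r d w (X i))
                + 2 * (fnet σ K L r d w (X i) - Y i)|
              ≤ 1 + 2 * |fnet σ K L r d w (X i) - Y i| := by
            refine (abs_add_le _ _).trans (add_le_add (hi.trans hu.le) ?_)
            rw [abs_mul, abs_two]
          calc _ ≤ e * (1 + 2 * |fnet σ K L r d w (X i) - Y i|) :=
                mul_le_mul hi h5 (abs_nonneg _) he0
            _ = _ := by ring
      _ = (n:ℝ)⁻¹ * ∑ _i : Fin n, e
          + 2 * e * ((n:ℝ)⁻¹ * ∑ i, |fnet σ K L r d w (X i) - Y i|) := by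
          rw [Finset.sum_add_distrib, mul_add]; congr 1; rw [← Finset.mul_sum]; ring
      _ ≤ e + 2 * e * (6 * Q) := by
          have := mean_const_le n e he0
          gcongr
      _ ≤ e * (13 * Q) := by nlinarith
      _ = _ := by rw [he]; ring
  have hgr : ‖gradient (empRisk σ K L r d n X Y) w‖
      = ‖fderiv ℝ (empRisk σ K L r d n X Y) w‖ := by
    unfold gradient; rw [LinearIsometryEquiv.norm_map]
  rw [hgr]
  refine key.trans ?_
  have hK32 : (K:ℝ) ^ ((3:ℝ)/2) = K * Real.sqrt K := by
    rw [Real.sqrt_eq_rpow, show (3:ℝ)/2 = 1 + 1/2 by norm_num,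
      Real.rpow_add (by linarith), Real.rpow_one]
  rw [hK32]
  have hB1 : 1 ≤ B ^ L := one_le_pow₀ hB
  have hG2 : M + γ * (C * B ^ L * α) ≤ M * (1 + C) * (γ * B ^ (2 * L) * α ^ 2) := by
    have e1 : B ^ L * α ≤ B ^ (2 * L) * α ^ 2 := by
      gcongr
      · omega
      · nlinarith
    have e2 : 1 ≤ γ * (B ^ L * α) :=
      one_le_mul_of_one_le_of_one_le hγ (one_le_mul_of_one_le_of_one_le hB1 hα)
    calc _ = M * 1 + 1 * C * (γ * (B ^ L * α)) := by ring
      _ ≤ M * (γ * (B ^ L * α)) + M * C * (γ * (B ^ L * α)) := by gcongr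
      _ = M * (1 + C) * (γ * (B ^ L * α)) := by ring
      _ ≤ M * (1 + C) * (γ * (B ^ (2 * L) * α ^ 2)) := by gcongr
      _ = _ := by ring
  calc G * (13 * Q) ≤ (M * (1 + C) * (γ * B ^ (2 * L) * α ^ 2)) * Real.sqrt K * (13 * Q) := by
        simp only [G]; gcongr
    _ = _ := by rw [hQ]; ring
end

section
/- Covering number bound for truncated over-parametrized networks (Lemma 4): let α ≥ 1, β > 0, A, B, C ≥ 1, and let σ : ℝ → ℝ be k-times differentiable with all derivatives up to order k bounded on ℝ. Let F be the set of all networks f_w whose weight vectors satisfy Σ_{j=1}^{K_n} |w^{(L)}_{1,1,j}| ≤ C, |w^{(l)}_{k,i,j}| ≤ B for all k ∈ {1,…,K_n}, i, j ∈ {1,…,r}, l ∈ {1,…,L−1}, and |w^{(0)}_{k,i,j}| ≤ A for all k ∈ {1,…,K_n}, i ∈ {1,…,r}, j ∈ {1,…,d}. Then there exist constants c₉, c₁₀, c₁₁ such that for any 1 ≤ p < ∞, 0 < ε < β and x_1^n ∈ (ℝ^d)^n: N_p(ε, {T_β f · 1_{[−α,α]^d} : f ∈ F}, x_1^n) ≤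 (c₉·β^p/ε^p)^{c₁₀·α^d·B^{(L−1)·d}·A^d·(C/ε)^{d/k} + c₁₁}. -/
open scoped BigOperators

/-- Truncation `T_β z = max{-β, min{β, z}}`. -/
def trunc (β z : ℝ) : ℝ := max (-β) (min β z)

/-- `g₁,…,g_N` (given as `g : Fin N → _`) is an `L_p` `ε`-cover of the function class `G`
on the points `x_1^n`. -/
def IsLpCover {d : ℕ} (p ε : ℝ) (G : Set ((Fin d → ℝ) → ℝ)) {n : ℕ}
    (xs : Fin n → Fin d → ℝ) {N : ℕ} (g : Fin N → (Fin d → ℝ) → ℝ) : Prop :=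
  ∀ f ∈ G, ∃ i : Fin N,
    ((n : ℝ)⁻¹ * ∑ s : Fin n, |f (xs s) - g i (xs s)| ^ p) ^ (1 / p) < ε

theorem interp_coef (k : ℕ) : ∃ (a : ℝ → ℕ → ℝ) (Λ : ℝ), 1 ≤ Λ ∧
    (∀ τ ∈ Set.Icc (0:ℝ) k, ∀ j ∈ Finset.range k, |a τ j| ≤ Λ) ∧
    ∀ i < k, ∀ τ : ℝ, τ ^ i = ∑ j ∈ Finset.range k, a τ j * (j:ℝ) ^ i := by
  set b : ℕ → Polynomial ℝ := fun j => Lagrange.basis (Finset.range k) (fun n : ℕ => (n:ℝ)) j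
  have hb : ∀ j : ℕ, ∃ B : ℝ, ∀ τ ∈ Set.Icc (0:ℝ) k, |(b j).eval τ| ≤ B := fun j =>
    isCompact_Icc.exists_bound_of_continuousOn (b j).continuous.continuousOn
  choose B hB using hb
  refine ⟨fun τ j => (b j).eval τ, 1 + ∑ j ∈ Finset.range k, |B j|, ?_, ?_, ?_⟩
  · have : 0 ≤ ∑ j ∈ Finset.range k, |B j| := Finset.sum_nonneg fun _ _ => abs_nonneg _
    linarith
  · intro τ hτ j hj
    have := Finset.single_le_sum (f := fun j => |B j|) (fun _ _ => abs_nonneg _) hj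
    have h2 := hB j τ hτ
    have h3 := le_abs_self (B j)
    simp only at this ⊢
    linarith
  · intro i hi τ
    have h := Lagrange.eq_interpolate (s := Finset.range k) (v := fun n : ℕ => (n:ℝ))
      (f := (Polynomial.X : Polynomial ℝ) ^ i)
      (fun x _ y _ h => Nat.cast_injective h)
      (by rw [Polynomial.degree_X_pow, Finset.card_range]; exact_mod_cast hi)
    have h2 := congrArg (Polynomial.eval τ) h
    rw [Lagrange.interpolate_apply] at h2
    simp only [Polynomial.eval_finsetSum, Polynomial.eval_pow, Polynomial.eval_X,
      Polynomial.eval_mul, Polynomial.eval_C] at h2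
    rw [h2]
    exact Finset.sum_congr rfl fun j _ => mul_comm _ _

theorem interp_bound (k : ℕ) (hk : 0 < k) : ∃ (a : ℝ → ℕ → ℝ) (Λ : ℝ), 1 ≤ Λ ∧
    (∀ τ ∈ Set.Icc (0:ℝ) k, ∀ j ∈ Finset.range k, |a τ j| ≤ Λ) ∧
    ∀ (u : ℝ → ℝ) (κ : ℝ), ContDiff ℝ (k : ℕ) u → (∀ t, |iteratedDeriv k u t| ≤ κ) →
      ∀ τ ∈ Set.Icc (0:ℝ) k, |u τ - ∑ j ∈ Finset.range k, a τ j * u j| ≤ Λ * κ := by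
  obtain ⟨a, Λ, hΛ, ha, hp⟩ := interp_coef k
  obtain ⟨n, rfl⟩ : ∃ n, k = n + 1 := ⟨k - 1, by omega⟩
  set m : ℝ := ((n + 1 : ℕ) : ℝ) with hm
  have hm1 : 1 ≤ m := by simp [hm]
  have hmk : 1 ≤ m ^ (n+1) := one_le_pow₀ hm1
  refine ⟨a, Λ + m ^ (n+1) + m * Λ * m ^ (n+1), ?_, ?_, ?_⟩
  · have : 0 ≤ m * Λ * m ^ (n+1) := by positivity
    linarith
  · intro τ hτ j hj
    have : 0 ≤ m * Λ * m ^ (n+1) := by positivity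
    linarith [ha τ hτ j hj]
  intro u κ hu hκ τ hτ
  have hκ0 : 0 ≤ κ := (abs_nonneg _).trans (hκ 0)
  set P : ℝ → ℝ := fun t => taylorWithinEval u n (Set.Icc 0 m) 0 t with hP
  have hR : ∀ t ∈ Set.Icc (0:ℝ) m, |u t - P t| ≤ κ * m ^ (n+1) := by
    intro t ht
    have := taylor_mean_remainder_bound (f := u) (a := 0) (b := m) (C := κ) (x := t) (n := n)
      (by linarith) (by exact_mod_cast hu.contDiffOn) ht (by
        intro y hy
        rw [iteratedDerivWithin_eq_iteratedDeriv (uniqueDiffOn_Icc (by linarith))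
          (by exact_mod_cast hu.contDiffAt) hy]
        exact hκ y)
    rw [Real.norm_eq_abs] at this
    refine this.trans ?_
    have h1 : (1:ℝ) ≤ (n.factorial : ℝ) := by exact_mod_cast Nat.succ_le_of_lt n.factorial_pos
    have h2 : (t - 0) ^ (n+1) ≤ m ^ (n+1) :=
      pow_le_pow_left₀ (by linarith [ht.1]) (by linarith [ht.2]) _
    have h3 : 0 ≤ κ * m ^ (n+1) := by positivity
    rw [div_le_iff₀ (by linarith)]
    nlinarith [mul_le_mul_of_nonneg_left h2 hκ0]
  have hPP : P τ = ∑ j ∈ Finset.range (n+1), a τ j * P j := by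
    have hPe : ∀ t, P t = ∑ i ∈ Finset.range (n+1),
        ((i.factorial : ℝ)⁻¹ * iteratedDerivWithin i u (Set.Icc 0 m) 0) * t ^ i := by
      intro t
      simp only [hP, taylor_within_apply, sub_zero, smul_eq_mul]
      exact Finset.sum_congr rfl fun i _ => by ring
    simp only [hPe, Finset.mul_sum]
    rw [Finset.sum_comm]
    refine Finset.sum_congr rfl fun i hi => ?_
    rw [hp i (Finset.mem_range.1 hi) τ, Finset.mul_sum]
    exact Finset.sum_congr rfl fun j _ => by ring
  have hsum : |∑ j ∈ Finset.range (n+1), a τ j * (u j - P j)| ≤ m * (Λ * (κ * m^(n+1))) := by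
    refine (Finset.abs_sum_le_sum_abs _ _).trans ?_
    refine (Finset.sum_le_card_nsmul _ _ (Λ * (κ * m^(n+1))) ?_).trans (by simp [hm])
    intro j hj
    rw [abs_mul]
    refine mul_le_mul (ha τ hτ j hj) (hR j ⟨by positivity, ?_⟩) (abs_nonneg _) (by linarith)
    rw [hm]; exact_mod_cast (Finset.mem_range.1 hj).le
  have e : u τ - ∑ j ∈ Finset.range (n+1), a τ j * u j
      = (u τ - P τ) - ∑ j ∈ Finset.range (n+1), a τ j * (u j - P j) := by
    simp only [mul_sub, Finset.sum_sub_distrib]; rw [← hPP]; ring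
  rw [e]
  refine (abs_sub _ _).trans ?_
  have h1 := hR τ hτ
  have : 0 ≤ Λ * κ := by positivity
  nlinarith

theorem layer_comp (k : ℕ) (σ : ℝ → ℝ) (hσ : ContDiff ℝ (k : ℕ) σ) (S : ℝ)
    (hS : ∀ i ≤ k, ∀ x, |iteratedDeriv i σ x| ≤ S) (E : ℝ) (hE : 0 ≤ E) (hS0 : 0 ≤ S)
    (v : ℝ → ℝ) (hv : ContDiff ℝ (k : ℕ) v)
    (hvd : ∀ i, 1 ≤ i → i ≤ k → ∀ t, |iteratedDeriv i v t| ≤ E ^ i) :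
    ContDiff ℝ (k : ℕ) (fun t => σ (v t)) ∧
    ∀ m ≤ k, ∀ t, |iteratedDeriv m (fun t => σ (v t)) t| ≤ (k.factorial * S) * E ^ m := by
  refine ⟨hσ.comp hv, fun m hm t => ?_⟩
  have := norm_iteratedFDeriv_comp_le (g := σ) (f := v) (n := m) hσ hv (by exact_mod_cast hm) t
    (C := S) (D := E)
    (fun i hi => by
      rw [norm_iteratedFDeriv_eq_norm_iteratedDeriv]; exact hS i (hi.trans hm) _)
    (fun i hi hi' => by
      rw [norm_iteratedFDeriv_eq_norm_iteratedDeriv]; exact hvd i hi (hi'.trans hm) _)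
  rw [norm_iteratedFDeriv_eq_norm_iteratedDeriv] at this
  refine this.trans ?_
  have : (m.factorial : ℝ) ≤ k.factorial := by exact_mod_cast Nat.factorial_le hm
  gcongr

theorem lin_comb_deriv {ι : Type*} (s : Finset ι) (k : ℕ) (c : ι → ℝ) (u : ι → ℝ → ℝ)
    (hu : ∀ i ∈ s, ContDiff ℝ (k : ℕ) (u i)) (m : ℕ) (hm : m ≤ k) (X : ℝ)
    (hX : ∀ i ∈ s, ∀ t, |iteratedDeriv m (u i) t| ≤ X) (t : ℝ) :
    |iteratedDeriv m (fun t => ∑ i ∈ s, c i * u i t) t| ≤ (∑ i ∈ s, |c i|) * X := by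
  rw [iteratedDeriv_fun_sum (fun i hi =>
    (contDiff_const.mul ((hu i hi).of_le (by exact_mod_cast hm))).contDiffAt)]
  refine (Finset.abs_sum_le_sum_abs _ _).trans ?_
  rw [Finset.sum_mul]
  refine Finset.sum_le_sum fun i hi => ?_
  rw [iteratedDeriv_const_mul_field, abs_mul]
  exact mul_le_mul_of_nonneg_left (hX i hi t) (abs_nonneg _)

theorem nOut_deriv (k : ℕ) (σ : ℝ → ℝ) (hσ : ContDiff ℝ (k : ℕ) σ) (S : ℝ) (hS1 : 1 ≤ S)
    (hS : ∀ i ≤ k, ∀ x, |iteratedDeriv i σ x| ≤ S) (K L r d : ℕ) (w : NNIdx K L r d → ℝ)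
    (A B δ : ℝ) (hA : 1 ≤ A) (hB : 1 ≤ B) (hδ : 0 ≤ δ)
    (hwB : ∀ (kk : Fin K) (i : Fin r) (l : Fin (L - 1)) (j : Fin r),
                    |w (NNIdx.inner l kk i j.succ)| ≤ B)
    (hwA : ∀ (kk : Fin K) (i : Fin r) (j : Fin d), |w (NNIdx.input kk i j.succ)| ≤ A)
    (p q : Fin d → ℝ) (hp : ∑ j, |p j| ≤ δ) (kk : Fin K) :
    ∀ l, l < L → ∀ i : Fin r,
      ContDiff ℝ (k : ℕ) (fun t => nOut σ K L r d w kk (l+1) i (fun j => q j + t * p j)) ∧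
      ∀ m ≤ k, ∀ t,
        |iteratedDeriv m (fun t => nOut σ K L r d w kk (l+1) i (fun j => q j + t * p j)) t|
          ≤ (k.factorial * S) * (((r+1) * (k.factorial * S) * B) ^ l * (A * δ)) ^ m := by
  have hf1 : (1:ℝ) ≤ k.factorial := by exact_mod_cast Nat.succ_le_of_lt k.factorial_pos
  have hQ : 1 ≤ k.factorial * S := one_le_mul_of_one_le_of_one_le hf1 hS1
  set Q := k.factorial * S with hQd
  intro l
  induction l with
  | zero =>
    intro _ i
    simp only [nOut, pow_zero, one_mul]
    set a : ℝ := ∑ j : Fin d, w (NNIdx.input kk i j.succ) * p j with ha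
    set b : ℝ := ∑ j : Fin d, w (NNIdx.input kk i j.succ) * q j + w (NNIdx.input kk i 0) with hb
    have hab : ∀ t : ℝ, (∑ j : Fin d, w (NNIdx.input kk i j.succ) * (q j + t * p j))
        + w (NNIdx.input kk i 0) = b + a * t := by
      intro t
      simp only [ha, hb, mul_add, Finset.sum_add_distrib, Finset.sum_mul]
      have : ∀ j : Fin d, w (NNIdx.input kk i j.succ) * (t * p j)
        = w (NNIdx.input kk i j.succ) * p j * t := fun j => by ring
      simp only [this]; ring
    simp only [hab]
    have haA : |a| ≤ A * δ := by
      refine (Finset.abs_sum_le_sum_abs _ _).trans ?_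
      calc ∑ j, |w (NNIdx.input kk i j.succ) * p j| ≤ ∑ j, A * |p j| :=
            Finset.sum_le_sum fun j _ => by
              rw [abs_mul]; exact mul_le_mul_of_nonneg_right (hwA kk i j) (abs_nonneg _)
        _ = A * ∑ j, |p j| := by rw [Finset.mul_sum]
        _ ≤ A * δ := mul_le_mul_of_nonneg_left hp (by linarith)
    refine layer_comp k σ hσ S hS (A * δ) (by positivity) (by linarith) _ (by fun_prop) ?_
    intro m hm hmk t
    rw [iteratedDeriv_const_add (by omega), iteratedDeriv_const_mul_field]
    obtain ⟨m, rfl⟩ : ∃ m', m = m' + 1 := ⟨m - 1, by omega⟩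
    rcases m with _ | m
    · simpa using haA
    · have : iteratedDeriv (m + 1 + 1) (fun x : ℝ => x) t = 0 := by
        rw [iteratedDeriv_succ', show deriv (fun x : ℝ => x) = fun _ => 1 by ext; simp,
          iteratedDeriv_const]; simp
      rw [this]; simp; positivity
  | succ l ih =>
    intro hl i
    have hl' : l < L - 1 := by omega
    have ih := ih (by omega)
    set E := ((r+1) * Q * B) ^ l * (A * δ) with hE
    have hE0 : 0 ≤ E := by positivity
    have hEE : ((r+1) * Q * B) ^ (l+1) * (A * δ) = (r+1) * Q * B * E := by rw [hE]; ring
    rw [hEE]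
    simp only [nOut, hl', dif_pos]
    refine layer_comp k σ hσ S hS _ (by positivity) (by linarith) _ ?_ ?_
    · exact (ContDiff.sum fun j _ => contDiff_const.mul (ih j).1).add contDiff_const
    · intro m hm hmk t
      have := lin_comb_deriv Finset.univ k (fun j : Fin r => w (NNIdx.inner ⟨l, hl'⟩ kk i j.succ))
        (fun j t => nOut σ K L r d w kk (l+1) j (fun j => q j + t * p j))
        (fun j _ => (ih j).1) m hmk (Q * E ^ m) (fun j _ t => (ih j).2 m hmk t) t
      have e : (fun t => (∑ j : Fin r, w (NNIdx.inner ⟨l, hl'⟩ kk i j.succ) *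
          nOut σ K L r d w kk (l + 1) j (fun j => q j + t * p j)) + w (NNIdx.inner ⟨l, hl'⟩ kk i 0))
         = (fun t => w (NNIdx.inner ⟨l, hl'⟩ kk i 0) + ∑ j : Fin r, w (NNIdx.inner ⟨l, hl'⟩ kk i j.succ) *
          nOut σ K L r d w kk (l + 1) j (fun j => q j + t * p j)) := by
        ext t; ring
      rw [e, iteratedDeriv_const_add (by omega)]
      refine this.trans ?_
      have h1 : ∑ j : Fin r, |w (NNIdx.inner ⟨l, hl'⟩ kk i j.succ)| ≤ (r + 1) * B := by
        refine (Finset.sum_le_card_nsmul _ _ B fun j _ => hwB kk i _ j).trans ?_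
        simp; nlinarith
      have h2 : 1 ≤ (r+1) * Q * B := by
        have : (1:ℝ) ≤ r + 1 := by have : (0:ℝ) ≤ r := by positivity
                                   linarith
        exact one_le_mul_of_one_le_of_one_le (one_le_mul_of_one_le_of_one_le this hQ) hB
      have h3 : (r+1) * Q * B ≤ ((r+1) * Q * B) ^ m := le_self_pow₀ h2 (by omega)
      calc _ ≤ (r+1) * B * (Q * E ^ m) := mul_le_mul_of_nonneg_right h1 (by positivity)
        _ = ((r+1) * Q * B) * E ^ m := by ring
        _ ≤ ((r+1) * Q * B) ^ m * E ^ m := mul_le_mul_of_nonneg_right h3 (by positivity)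
        _ = _ := (mul_pow _ _ _).symm

theorem fnet_deriv (k : ℕ) (σ : ℝ → ℝ) (hσ : ContDiff ℝ (k : ℕ) σ) (S : ℝ) (hS1 : 1 ≤ S)
    (hS : ∀ i ≤ k, ∀ x, |iteratedDeriv i σ x| ≤ S) (K L r d : ℕ) (w : NNIdx K L r d → ℝ)
    (A B C δ : ℝ) (hA : 1 ≤ A) (hB : 1 ≤ B) (hδ : 0 ≤ δ)
    (hwC : ∑ j : Fin K, |w (NNIdx.out j)| ≤ C)
    (hwB : ∀ (kk : Fin K) (i : Fin r) (l : Fin (L - 1)) (j : Fin r),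
                    |w (NNIdx.inner l kk i j.succ)| ≤ B)
    (hwA : ∀ (kk : Fin K) (i : Fin r) (j : Fin d), |w (NNIdx.input kk i j.succ)| ≤ A)
    (p q : Fin d → ℝ) (hp : ∑ j, |p j| ≤ δ) :
      ContDiff ℝ (k : ℕ) (fun t => fnet σ K L r d w (fun j => q j + t * p j)) ∧
      ∀ m ≤ k, ∀ t,
        |iteratedDeriv m (fun t => fnet σ K L r d w (fun j => q j + t * p j)) t|
          ≤ C * ((k.factorial * S) * (((r+1) * (k.factorial * S) * B) ^ (L-1) * (A * δ)) ^ m) := by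
  have hC : 0 ≤ C := (Finset.sum_nonneg fun _ _ => abs_nonneg _).trans hwC
  have hS0 : 0 ≤ S := by linarith
  have triv : ContDiff ℝ (k : ℕ) (fun t : ℝ => (0:ℝ)) ∧ ∀ m ≤ k, ∀ t,
        |iteratedDeriv m (fun t : ℝ => (0:ℝ)) t|
          ≤ C * ((k.factorial * S) * (((r+1) * (k.factorial * S) * B) ^ (L-1) * (A * δ)) ^ m) := by
    refine ⟨contDiff_const, fun m _ t => ?_⟩
    rw [iteratedDeriv_fun_const_zero]
    simp only [abs_zero]
    positivity
  by_cases hr : 0 < r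
  swap
  · simpa only [fnet, hr, dif_neg, not_false_eq_true] using triv
  by_cases hL : L = 0
  · subst hL
    simpa only [fnet, hr, dif_pos, nOut, mul_zero, Finset.sum_const_zero] using triv
  obtain ⟨l, rfl⟩ : ∃ l, L = l + 1 := ⟨L - 1, by omega⟩
  have h := fun kk => nOut_deriv k σ hσ S hS1 hS K (l+1) r d w A B δ hA hB hδ hwB hwA p q hp kk l
    (by omega) ⟨0, hr⟩
  simp only [fnet, hr, dif_pos, Nat.add_sub_cancel]
  refine ⟨ContDiff.sum fun j _ => contDiff_const.mul (h j).1, fun m hm t => ?_⟩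
  refine (lin_comb_deriv Finset.univ k (fun j => w (NNIdx.out j)) _ (fun j _ => (h j).1) m hm _
    (fun j _ t => (h j).2 m hm t) t).trans ?_
  exact mul_le_mul_of_nonneg_right hwC (by positivity)

def LineSmooth {d : ℕ} (k : ℕ) (η : ℝ) (f : (Fin d → ℝ) → ℝ) : Prop :=
  ∀ (z : Fin d → ℝ) (j : Fin d) (s : ℝ),
    ContDiff ℝ (k : ℕ) (fun t : ℝ => f (Function.update z j (s + t))) ∧
    ∀ t, |iteratedDeriv k (fun t : ℝ => f (Function.update z j (s + t))) t| ≤ η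

noncomputable def qz {d : ℕ} (η : ℝ) (f : (Fin d → ℝ) → ℝ) (z : Fin d → ℕ) : ℤ :=
  ⌊f (fun j => (z j : ℝ)) / η⌋

noncomputable def prd {d : ℕ} (k : ℕ) (a : ℕ → ℝ) (q : (Fin d → ℕ) → ℤ) (z : Fin d → ℕ)
    (j : Fin d) : ℤ :=
  ⌊∑ i ∈ Finset.range k, a i * (q (Function.update z j (z j - k + i)) : ℝ)⌋

open Classical in
noncomputable def cod {d : ℕ} (k : ℕ) (a : ℕ → ℝ) (q : (Fin d → ℕ) → ℤ) (z : Fin d → ℕ) : ℤ :=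
  if h : ∃ j, k ≤ z j then q z - prd k a q z h.choose else q z

theorem cod_inj {d : ℕ} (k : ℕ) (a : ℕ → ℝ) (q q' : (Fin d → ℕ) → ℤ) (M : ℕ)
    (h : ∀ z : Fin d → ℕ, (∀ j, z j ≤ M) → cod k a q z = cod k a q' z) :
    ∀ z : Fin d → ℕ, (∀ j, z j ≤ M) → q z = q' z := by
  have key : ∀ n, ∀ z : Fin d → ℕ, ∑ j, z j = n → (∀ j, z j ≤ M) → q z = q' z := by
    intro n
    induction n using Nat.strong_induction_on with
    | _ n ih =>
      intro z hz hzM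
      have hc := h z hzM
      unfold cod at hc
      by_cases hj : ∃ j, k ≤ z j
      · simp only [hj, dif_pos] at hc
        set j := hj.choose with hjd
        have hkj : k ≤ z j := hj.choose_spec
        have : prd k a q z j = prd k a q' z j := by
          unfold prd
          congr 1
          refine Finset.sum_congr rfl fun i hi => ?_
          have hi := Finset.mem_range.1 hi
          have hlt : z j - k + i < z j := by omega
          rw [ih _ ?_ (Function.update z j (z j - k + i)) rfl ?_]
          · rw [← hz]
            refine Finset.sum_lt_sum (fun x _ => ?_) ⟨j, Finset.mem_univ _, by simpa using hlt⟩
            by_cases hx : x = j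
            · subst hx; simpa using hlt.le
            · simp [hx]
          · intro x
            by_cases hx : x = j
            · subst hx; simpa using hlt.le.trans (hzM _)
            · simpa [hx] using hzM x
        rw [this] at hc
        linarith
      · simpa only [hj, dif_neg, not_false_eq_true] using hc
  exact fun z => key _ z rfl

theorem cast_update {d : ℕ} (z : Fin d → ℕ) (j : Fin d) (m : ℕ) :
    (fun x => ((Function.update z j m x : ℕ) : ℝ)) = Function.update (fun x => (z x : ℝ)) j (m:ℝ) := by
  ext x
  by_cases hx : x = j
  · subst hx; simp
  · simp [hx]

theorem cod_bound {d : ℕ} (k : ℕ) (a : ℝ → ℕ → ℝ) (Λ : ℝ) (hΛ : 1 ≤ Λ)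
    (ha : ∀ τ ∈ Set.Icc (0:ℝ) k, ∀ j ∈ Finset.range k, |a τ j| ≤ Λ)
    (hi : ∀ (u : ℝ → ℝ) (κ : ℝ), ContDiff ℝ (k : ℕ) u → (∀ t, |iteratedDeriv k u t| ≤ κ) →
      ∀ τ ∈ Set.Icc (0:ℝ) k, |u τ - ∑ j ∈ Finset.range k, a τ j * u j| ≤ Λ * κ)
    (η : ℝ) (hη : 0 < η) (f : (Fin d → ℝ) → ℝ) (hf : LineSmooth k η f) (z : Fin d → ℕ)
    (hz : ∃ j, k ≤ z j) : |((cod k (a k) (qz η f) z : ℤ) : ℝ)| ≤ (k + 1) * Λ + 2 := by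
  unfold cod
  simp only [hz, dif_pos]
  set j := hz.choose
  have hkj : k ≤ z j := hz.choose_spec
  have hfl : ∀ z, |(qz η f z : ℝ) - f (fun j => (z j : ℝ)) / η| ≤ 1 := by
    intro z
    unfold qz
    rw [abs_le]
    constructor <;> linarith [Int.floor_le (f (fun j => (z j : ℝ)) / η),
      Int.lt_floor_add_one (f (fun j => (z j : ℝ)) / η)]
  obtain ⟨h1, h2⟩ := hf (fun x => (z x : ℝ)) j ((z j : ℝ) - k)
  have hkk : (k:ℝ) ∈ Set.Icc (0:ℝ) k := ⟨by positivity, le_rfl⟩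
  have h3 := hi _ η h1 h2 k hkk
  have e1 : Function.update (fun x => (z x : ℝ)) j ((z j : ℝ) - k + k) = fun x => (z x : ℝ) := by
    rw [sub_add_cancel]; exact Function.update_eq_self j (fun x => (z x : ℝ))
  have e2 : ∀ i : ℕ, Function.update (fun x => (z x : ℝ)) j ((z j : ℝ) - k + i)
      = fun x => ((Function.update z j (z j - k + i) x : ℕ) : ℝ) := by
    intro i
    rw [cast_update]; push_cast [hkj]; rfl
  simp only [e1, e2] at h3
  set v : (Fin d → ℕ) → ℝ := fun z => f (fun j => (z j : ℝ)) / η with hv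
  have h4 : |v z - ∑ i ∈ Finset.range k, a k i * v (Function.update z j (z j - k + i))| ≤ Λ := by
    have : v z - ∑ i ∈ Finset.range k, a k i * v (Function.update z j (z j - k + i))
      = (f (fun x => (z x : ℝ)) - ∑ i ∈ Finset.range k, a k i *
        f (fun x => ((Function.update z j (z j - k + i) x : ℕ) : ℝ))) / η := by
      rw [sub_div, Finset.sum_div]
      simp only [hv, mul_div_assoc]
    rw [this, abs_div, abs_of_pos hη, div_le_iff₀ hη]
    exact h3
  have h5 : |∑ i ∈ Finset.range k, a k i * ((qz η f (Function.update z j (z j - k + i)) : ℝ)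
      - v (Function.update z j (z j - k + i)))| ≤ k * Λ := by
    refine (Finset.abs_sum_le_sum_abs _ _).trans ?_
    refine (Finset.sum_le_card_nsmul _ _ Λ ?_).trans (by simp)
    intro i hi
    rw [abs_mul]
    calc _ ≤ Λ * 1 := mul_le_mul (ha k hkk i hi) (hfl _) (abs_nonneg _) (by linarith)
      _ = Λ := mul_one _
  simp only [mul_sub, Finset.sum_sub_distrib] at h5
  have h6 := hfl z
  unfold prd
  push_cast
  set W := ∑ i ∈ Finset.range k, a k i * (qz η f (Function.update z j (z j - k + i)) : ℝ)
  have h7 := Int.floor_le W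
  have h8 := Int.lt_floor_add_one W
  change |(qz η f z : ℝ) - v z| ≤ 1 at h6
  rw [abs_le] at *
  constructor <;> nlinarith [h4.1, h4.2, h5.1, h5.2, h6.1, h6.2]

theorem recover {d : ℕ} (k : ℕ) (hk : 0 < k) (a : ℝ → ℕ → ℝ) (Λ : ℝ) (hΛ : 1 ≤ Λ)
    (ha : ∀ τ ∈ Set.Icc (0:ℝ) k, ∀ j ∈ Finset.range k, |a τ j| ≤ Λ)
    (hi : ∀ (u : ℝ → ℝ) (κ : ℝ), ContDiff ℝ (k : ℕ) u → (∀ t, |iteratedDeriv k u t| ≤ κ) →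
      ∀ τ ∈ Set.Icc (0:ℝ) k, |u τ - ∑ j ∈ Finset.range k, a τ j * u j| ≤ Λ * κ)
    (M : ℕ) (hM : k ≤ M) (η : ℝ) (hη : 0 < η) (h : (Fin d → ℝ) → ℝ) (hh : LineSmooth k (2*η) h)
    (hg : ∀ z : Fin d → ℕ, (∀ j, z j ≤ M) → |h (fun j => (z j : ℝ))| ≤ η) (s : Finset (Fin d)) :
    ∀ z : Fin d → ℝ, (∀ j, 0 ≤ z j ∧ z j ≤ M) → (∀ j ∉ s, ∃ m : ℕ, z j = m) →
      |h z| ≤ ((k + 2) * Λ) ^ s.card * η := by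
  induction s using Finset.induction_on with
  | empty =>
    intro z hz hm
    choose m hm using fun j => hm j (Finset.notMem_empty _)
    have e : z = fun j => (m j : ℝ) := funext hm
    rw [e]
    simp only [Finset.card_empty, pow_zero, one_mul]
    refine hg m fun j => ?_
    have := (hz j).2
    rw [hm] at this
    exact_mod_cast this
  | insert j s hj ih =>
    intro z hz hm
    rw [Finset.card_insert_of_notMem hj]
    set c := ((k + 2) * Λ) ^ s.card with hc
    have hbase : 1 ≤ (k + 2) * Λ := by
      have : (0:ℝ) ≤ k := by positivity
      nlinarith
    have hc1 : 1 ≤ c := one_le_pow₀ hbase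
    obtain ⟨m, hm1, hm2, hm3⟩ : ∃ m : ℕ, (m:ℝ) ≤ z j ∧ z j ≤ m + k ∧ m + k ≤ M := by
      have hk1 : (1:ℝ) ≤ k := by exact_mod_cast hk
      by_cases hc : ⌊z j⌋₊ ≤ M - k
      · exact ⟨⌊z j⌋₊, Nat.floor_le (hz j).1, by linarith [Nat.lt_floor_add_one (z j)], by omega⟩
      · refine ⟨M - k, ?_, ?_, by omega⟩
        · exact (Nat.cast_le.2 (by omega : M - k ≤ ⌊z j⌋₊)).trans (Nat.floor_le (hz j).1)
        · push_cast [hM]; linarith [(hz j).2]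
    obtain ⟨h1, h2⟩ := hh z j m
    have hτ : z j - m ∈ Set.Icc (0:ℝ) k := ⟨by linarith, by linarith⟩
    have h3 := hi _ _ h1 h2 (z j - m) hτ
    simp only [add_sub_cancel, Function.update_eq_self] at h3
    have h4 : |∑ i ∈ Finset.range k, a (z j - m) i * h (Function.update z j ((m:ℝ) + i))|
        ≤ k * (Λ * (c * η)) := by
      refine (Finset.abs_sum_le_sum_abs _ _).trans ?_
      refine (Finset.sum_le_card_nsmul _ _ (Λ * (c * η)) ?_).trans (by simp)
      intro i hik
      rw [abs_mul]
      refine mul_le_mul (ha _ hτ i hik) (ih _ ?_ ?_) (abs_nonneg _) (by linarith)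
      · intro x
        by_cases hx : x = j
        · subst hx
          simp only [Function.update_self]
          refine ⟨by positivity, ?_⟩
          have := Finset.mem_range.1 hik
          exact_mod_cast (by omega : m + i ≤ M)
        · simpa [hx] using hz x
      · intro x hxs
        by_cases hx : x = j
        · subst hx; exact ⟨m + i, by simp⟩
        · simpa [hx] using hm x (by simp [hx, hxs])
    have h5 : |h z| ≤ k * (Λ * (c * η)) + Λ * (2 * η) := by
      rw [abs_le] at *
      constructor <;> linarith [h3.1, h3.2, h4.1, h4.2]
    refine h5.trans ?_
    rw [pow_succ, ← hc]
    have : Λ * (2*η) ≤ Λ * (2 * (c * η)) := by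
      have : η ≤ c * η := le_mul_of_one_le_left hη.le hc1
      gcongr
    nlinarith

theorem KT (d k : ℕ) (hk : 0 < k) : ∃ c a : ℝ, 1 ≤ c ∧ 1 ≤ a ∧
    ∀ (M : ℕ) (η R : ℝ), k ≤ M → 0 < η → 0 ≤ R → ∀ G : Set ((Fin d → ℝ) → ℝ),
      (∀ f ∈ G, LineSmooth k η f ∧ ∀ z, |f z| ≤ R) →
      ∃ (N : ℕ) (g : Fin N → (Fin d → ℝ) → ℝ),
        (∀ f ∈ G, ∃ i, ∀ z : Fin d → ℝ, (∀ j, 0 ≤ z j ∧ z j ≤ M) → |f z - g i z| ≤ c * η) ∧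
        (N : ℝ) ≤ a ^ ((M+1)^d) * (2 * (R/η) + 5) ^ (k^d) := by
  classical
  obtain ⟨a, Λ, hΛ, ha, hi⟩ := interp_bound k hk
  have hk0 : (0:ℝ) ≤ k := by positivity
  have hbase : 1 ≤ (k + 2) * Λ := by nlinarith
  set B1 : ℕ := ⌈(k+1) * Λ + 2⌉₊ with hB1
  refine ⟨((k + 2) * Λ) ^ d, ((2 * B1 + 1 : ℕ) : ℝ), one_le_pow₀ hbase, by
    exact_mod_cast (by omega : 1 ≤ 2 * B1 + 1), ?_⟩
  intro M η R hM hη hR G hG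
  set B2 : ℕ := ⌈R/η⌉₊ + 1 with hB2
  set Z := Fin d → Fin (M+1)
  set cd : ((Fin d → ℝ) → ℝ) → Z → ℤ := fun f z => cod k (a k) (qz η f) (fun j => (z j : ℕ)) with hcd
  set T : Finset (Z → ℤ) := Fintype.piFinset (fun z : Z =>
    if (∃ j, k ≤ (z j : ℕ)) then Finset.Icc (-(B1:ℤ)) B1 else Finset.Icc (-(B2:ℤ)) B2) with hT
  have hmem : ∀ f ∈ G, cd f ∈ T := by
    intro f hf
    rw [hT, Fintype.mem_piFinset]
    intro z
    by_cases hz : ∃ j, k ≤ (z j : ℕ)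
    · simp only [hz, if_true, Finset.mem_Icc]
      have := (cod_bound k a Λ hΛ ha hi η hη f (hG f hf).1 (fun j => (z j : ℕ)) hz).trans
        (Nat.le_ceil _)
      rw [← hB1, abs_le] at this
      exact_mod_cast this
    · simp only [hz, if_false, Finset.mem_Icc, hcd, cod, dif_neg, not_false_eq_true]
      have h1 := (hG f hf).2 (fun j => ((z j : ℕ) : ℝ))
      have h2 : |f (fun j => ((z j : ℕ) : ℝ)) / η| ≤ R / η := by
        rw [abs_div, abs_of_pos hη]; gcongr
      have h3 := h2.trans (Nat.le_ceil _)
      rw [abs_le] at h3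
      have h4 := Int.floor_le (f (fun j => ((z j : ℕ) : ℝ)) / η)
      have h5 := Int.lt_floor_add_one (f (fun j => ((z j : ℕ) : ℝ)) / η)
      unfold qz
      constructor
      · have : (-(B2:ℝ)) ≤ (⌊f (fun j => ((z j : ℕ) : ℝ)) / η⌋ : ℝ) := by
          rw [hB2]; push_cast; linarith
        exact_mod_cast this
      · have : (⌊f (fun j => ((z j : ℕ) : ℝ)) / η⌋ : ℝ) ≤ B2 := by
          rw [hB2]; push_cast; linarith
        exact_mod_cast this
  refine ⟨T.card, fun i => if h : ∃ f ∈ G, cd f = (T.equivFin.symm i : Z → ℤ) then h.choose else 0,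
    ?_, ?_⟩
  · intro f hf
    refine ⟨T.equivFin ⟨cd f, hmem f hf⟩, ?_⟩
    have hex : ∃ f' ∈ G, cd f' = (T.equivFin.symm (T.equivFin ⟨cd f, hmem f hf⟩) : Z → ℤ) :=
      ⟨f, hf, by simp⟩
    simp only [hex, dif_pos]
    set g := hex.choose with hg
    have hgG : g ∈ G := hex.choose_spec.1
    have hgc : cd g = cd f := hex.choose_spec.2.trans (by simp)
    have hq := cod_inj k (a k) (qz η g) (qz η f) M (fun z hz => by
      have := congrFun hgc (fun j => ⟨z j, Nat.lt_succ_of_le (hz j)⟩)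
      simpa [hcd] using this)
    intro z hz
    have := recover k hk a Λ hΛ ha hi M hM η hη (fun z => f z - g z) ?_ ?_ Finset.univ z hz (by simp)
    · simpa using this
    · intro z j s
      obtain ⟨h1, h2⟩ := (hG f hf).1 z j s
      obtain ⟨h3, h4⟩ := (hG g hgG).1 z j s
      refine ⟨h1.sub h3, fun t => ?_⟩
      have := iteratedDeriv_fun_sub (n := k) (x := t) h1.contDiffAt h3.contDiffAt
      rw [this]
      refine (abs_sub _ _).trans ?_
      linarith [h2 t, h4 t]
    · intro z hz
      have := hq z hz
      unfold qz at this
      have := (Int.abs_sub_lt_one_of_floor_eq_floor this).le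
      rw [← sub_div, abs_div, abs_of_pos hη, div_le_one hη] at this
      rw [abs_sub_comm]; exact this
  · have hcard : T.card = ∏ z : Z, if (∃ j, k ≤ (z j : ℕ)) then (2*B1+1) else (2*B2+1) := by
      rw [hT, Fintype.card_piFinset]
      refine Finset.prod_congr rfl fun z _ => ?_
      split_ifs <;> simp <;> omega
    have hle : T.card ≤ (2*B1+1) ^ ((M+1)^d) * (2*B2+1) ^ (k^d) := by
      rw [hcard, Finset.prod_ite, Finset.prod_const, Finset.prod_const]
      refine Nat.mul_le_mul (Nat.pow_le_pow_right (by omega) ?_) (Nat.pow_le_pow_right (by omega) ?_)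
      · refine (Finset.card_filter_le _ _).trans ?_
        simp [Z]
      · have : (Finset.univ.filter fun z : Z => ¬ ∃ j, k ≤ (z j : ℕ)).card
            ≤ (Finset.univ : Finset (Fin d → Fin k)).card := by
          refine Finset.card_le_card_of_injOn
            (fun z j => if h : (z j : ℕ) < k then ⟨z j, h⟩ else ⟨0, hk⟩) (by simp) ?_
          intro z hz z' hz' he
          simp only [Finset.coe_filter, Set.mem_ofPred_eq, not_exists, not_le, Finset.mem_univ,
            true_and] at hz hz'
          ext j
          have := congrFun he j
          simpa [hz j, hz' j] using this
        simpa using this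
    have hB2' : ((2 * B2 + 1 : ℕ) : ℝ) ≤ 2 * (R/η) + 5 := by
      have := (Nat.ceil_lt_add_one (by positivity : 0 ≤ R/η)).le
      rw [hB2]; push_cast; linarith
    calc (T.card : ℝ) ≤ ((2*B1+1 : ℕ) : ℝ) ^ ((M+1)^d) * ((2*B2+1 : ℕ) : ℝ) ^ (k^d) := by
          exact_mod_cast hle
      _ ≤ _ := by gcongr

theorem mean_le {n : ℕ} (u : Fin n → ℝ) (b ε p : ℝ) (hb : 0 ≤ b) (hbε : b < ε) (hp : 1 ≤ p)
    (hu : ∀ s, |u s| ≤ b) : ((n : ℝ)⁻¹ * ∑ s : Fin n, |u s| ^ p) ^ (1 / p) < ε := by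
  refine lt_of_le_of_lt ?_ hbε
  have hp0 : 0 < p := by linarith
  have h1 : ∑ s : Fin n, |u s| ^ p ≤ n * b ^ p := by
    refine (Finset.sum_le_card_nsmul _ _ (b ^ p) fun s _ =>
      Real.rpow_le_rpow (abs_nonneg _) (hu s) hp0.le).trans (by simp)
  have h2 : (n : ℝ)⁻¹ * ∑ s : Fin n, |u s| ^ p ≤ b ^ p := by
    rcases Nat.eq_zero_or_pos n with rfl | hn
    · simp; positivity
    · have : (0:ℝ) < n := by exact_mod_cast hn
      rw [inv_mul_le_iff₀ this]; exact h1
  calc _ ≤ (b ^ p) ^ (1/p) := Real.rpow_le_rpow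
        (mul_nonneg (by positivity) (Finset.sum_nonneg fun _ _ => by positivity)) h2 (by positivity)
    _ = b := by rw [← Real.rpow_mul hb, mul_one_div_cancel hp0.ne', Real.rpow_one]

theorem trunc_lip (β x y : ℝ) : |trunc β x - trunc β y| ≤ |x - y| := by
  unfold trunc
  refine (abs_max_sub_max_le_max _ _ _ _).trans ?_
  rw [sub_self, abs_zero]
  refine max_le (abs_nonneg _) ?_
  refine (abs_min_sub_min_le_max _ _ _ _).trans ?_
  rw [sub_self, abs_zero]
  exact max_le (abs_nonneg _) le_rfl

theorem base_le (β ε p : ℝ) (hε : 0 < ε) (hβ : ε < β) (hp : 1 ≤ p) :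
    β / ε ≤ β ^ p / ε ^ p := by
  have hβ0 : 0 < β := hε.trans hβ
  rw [← Real.div_rpow hβ0.le hε.le]
  have h1 : 1 ≤ β / ε := by rw [le_div_iff₀ hε]; linarith
  exact Real.self_le_rpow_of_one_le h1 hp

theorem final_num (N E β ε p : ℝ) (hε : 0 < ε) (hβ : ε < β) (hp : 1 ≤ p) (hE : 0 ≤ E)
    (hN : N ≤ Real.exp E) : N ≤ (Real.exp 1 * β ^ p / ε ^ p) ^ E := by
  refine hN.trans ?_
  rw [← Real.exp_one_rpow E]
  refine Real.rpow_le_rpow (Real.exp_pos _).le ?_ hE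
  have h1 : 1 ≤ β / ε := by rw [le_div_iff₀ hε]; linarith
  have := h1.trans (base_le β ε p hε hβ hp)
  rw [mul_div_assoc]
  nlinarith [Real.exp_pos 1]

theorem num_bound (d k : ℕ) (hd : 0 < d) (hk : 0 < k) (a c2 b : ℝ) (ha : 1 ≤ a) (hc2 : 0 ≤ c2)
    (hb : 1 ≤ b) (X y N T : ℝ) (M : ℕ) (hX : 0 ≤ X) (hy : 0 < y)
    (hyX : y ^ ((d:ℝ)/k) ≤ X ^ d) (hM : ((M:ℝ) + 1) ≤ c2 * (X + 1)) (hT0 : 0 ≤ T)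
    (hT : T ≤ b * (y + 1))
    (hN : N ≤ a ^ ((M+1)^d) * T ^ (k^d)) :
    N ≤ Real.exp ((Real.log a * c2 ^ d * 2 ^ d + k ^ d * k) * X ^ d
      + (Real.log a * c2 ^ d * 2 ^ d + k ^ d * Real.log (2 * b) + 1)) := by
  have hd' : (1:ℝ) ≤ d := by exact_mod_cast hd
  have hk' : (0:ℝ) < k := by exact_mod_cast hk
  have ha0 : 0 < a := by linarith
  have hla : 0 ≤ Real.log a := Real.log_nonneg ha
  have h1 : a ^ ((M+1)^d) ≤ Real.exp (Real.log a * (c2 ^ d * (2 ^ d * (X ^ d + 1)))) := by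
    have e : a ^ ((M+1)^d) = Real.exp (Real.log a * ((M:ℝ)+1)^d) := by
      rw [← Real.rpow_natCast, Real.rpow_def_of_pos ha0]; push_cast; rfl
    rw [e, Real.exp_le_exp]
    refine mul_le_mul_of_nonneg_left ?_ hla
    have h2 : (X + 1) ^ d ≤ 2 ^ d * (X ^ d + 1) := by
      have hXd : 0 ≤ X ^ d := by positivity
      rcases le_total X 1 with h | h
      · calc (X+1)^d ≤ 2 ^ d := by gcongr; linarith
          _ ≤ 2 ^ d * (X ^ d + 1) := le_mul_of_one_le_right (by positivity) (by linarith)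
      · calc (X+1)^d ≤ (2 * X) ^ d := by gcongr; linarith
          _ = 2 ^ d * X ^ d := mul_pow _ _ _
          _ ≤ _ := by gcongr; linarith
    calc ((M:ℝ)+1)^d ≤ (c2 * (X+1)) ^ d := by gcongr
      _ = c2 ^ d * (X+1)^d := mul_pow _ _ _
      _ ≤ _ := by gcongr
  have h3 : T ≤ Real.exp (Real.log (2*b) + k * X ^ d) := by
    rw [Real.exp_add, Real.exp_log (by linarith)]
    have hs : (0:ℝ) < (d:ℝ)/k := by positivity
    have h4 := Real.log_le_rpow_div hy.le hs
    have h5 : y ^ ((d:ℝ)/k) / ((d:ℝ)/k) ≤ k * X ^ d := by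
      rw [div_div_eq_mul_div, div_le_iff₀ (by linarith)]
      have : 0 ≤ y ^ ((d:ℝ)/k) := by positivity
      have h6 : y ^ ((d:ℝ)/k) * k ≤ k * X ^ d := by nlinarith
      have h7 : 0 ≤ k * X ^ d := by positivity
      nlinarith
    have h6 : y ≤ Real.exp (k * X ^ d) := by
      rw [← Real.log_le_iff_le_exp hy]; exact h4.trans h5
    have h7 : 1 ≤ Real.exp (k * X ^ d) := Real.one_le_exp (by positivity)
    nlinarith
  have h8 : T ^ (k^d) ≤ Real.exp (k ^ d * (Real.log (2*b) + k * X ^ d)) := by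
    calc T ^ (k^d) ≤ (Real.exp (Real.log (2*b) + k * X ^ d)) ^ (k^d) := by gcongr
      _ = _ := by rw [← Real.exp_nat_mul]; push_cast; rfl
  refine hN.trans ((mul_le_mul h1 h8 (by positivity) (Real.exp_pos _).le).trans ?_)
  rw [← Real.exp_add, Real.exp_le_exp]
  nlinarith

theorem dim_zero (L r k : ℕ) (σ : ℝ → ℝ) :
    ∃ c9 c10 c11 : ℝ, 0 < c9 ∧ 0 < c10 ∧ 0 < c11 ∧
      ∀ (K : ℕ) (α β A B C p ε : ℝ), 1 ≤ α → 0 < β → 1 ≤ A → 1 ≤ B → 1 ≤ C →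
        1 ≤ p → 0 < ε → ε < β →
        ∀ (n : ℕ) (xs : Fin n → Fin 0 → ℝ),
          ∃ (N : ℕ) (g : Fin N → (Fin 0 → ℝ) → ℝ),
            IsLpCover p ε
              {f : (Fin 0 → ℝ) → ℝ |
                ∃ w : NNIdx K L r 0 → ℝ,
                  (∑ j : Fin K, |w (NNIdx.out j)| ≤ C) ∧
                  (∀ (kk : Fin K) (i : Fin r) (l : Fin (L - 1)) (j : Fin r),
                    |w (NNIdx.inner l kk i j.succ)| ≤ B) ∧
                  (∀ (kk : Fin K) (i : Fin r) (j : Fin 0),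
                    |w (NNIdx.input kk i j.succ)| ≤ A) ∧
                  f = Set.indicator {x : Fin 0 → ℝ | ∀ j, |x j| ≤ α}
                        (fun x => trunc β (fnet σ K L r 0 w x))}
              xs g ∧
            (N : ℝ) ≤ (c9 * β ^ p / ε ^ p)
              ^ (c10 * α ^ 0 * B ^ ((L - 1) * 0) * A ^ 0 * (C / ε) ^ (((0:ℕ) : ℝ) / (k : ℝ))
                  + c11) := by
  refine ⟨3, 1, 1, by norm_num, by norm_num, by norm_num, ?_⟩
  intro K α β A B C p ε _ hβ _ _ _ hp hε hεβ n xs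
  refine ⟨⌊2 * β / ε⌋₊ + 1, fun i _ => -β + ε * (i : ℕ), ?_, ?_⟩
  · rintro f ⟨w, -, -, -, rfl⟩
    set v := trunc β (fnet σ K L r 0 w 0) with hv
    have hv1 : -β ≤ v := le_max_left _ _
    have hv2 : v ≤ β := max_le (by linarith) (min_le_left _ _)
    have hq0 : 0 ≤ (v + β) / ε := div_nonneg (by linarith) hε.le
    have hfl := Nat.floor_le hq0
    have hfl2 := Nat.lt_floor_add_one ((v + β) / ε)
    rw [le_div_iff₀ hε] at hfl
    rw [div_lt_iff₀ hε] at hfl2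
    refine ⟨⟨⌊(v + β) / ε⌋₊, Nat.lt_succ_of_le (Nat.floor_le_floor ?_)⟩, ?_⟩
    · gcongr; linarith
    · refine mean_le _ |v - (-β + ε * (⌊(v + β) / ε⌋₊ : ℕ))| ε p (abs_nonneg _) ?_ hp ?_
      · rw [abs_lt]; constructor <;> nlinarith
      · intro s
        have : xs s = 0 := Subsingleton.elim _ _
        simp [this, hv]
  · have h1 : 1 ≤ β / ε := by rw [le_div_iff₀ hε]; linarith
    have h2 := base_le β ε p hε hεβ hp
    have h3 : 3 * β ^ p / ε ^ p = 3 * (β ^ p / ε ^ p) := mul_div_assoc _ _ _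
    have h4 := Nat.floor_le (by positivity : 0 ≤ 2 * β / ε)
    have h5 : 2 * β / ε = 2 * (β / ε) := mul_div_assoc _ _ _
    simp only [pow_zero, mul_zero, Nat.cast_zero, zero_div, Real.rpow_zero, mul_one, h3]
    push_cast
    calc (⌊2 * β / ε⌋₊ : ℝ) + 1 ≤ 3 * (β ^ p / ε ^ p) := by linarith
      _ ≤ _ := Real.self_le_rpow_of_one_le (by linarith) (by norm_num)

set_option maxHeartbeats 2000000 in
/-- Lemma 4: covering number bound for truncated over-parametrized deep networks.  The
bound `N_p(ε, {T_β f · 1_{[-α,α]^d} : f ∈ F}, x_1^n) ≤ (c₉·β^p/ε^p)^{c₁₀·α^d·B^{(L-1)d}·A^d·(C/ε)^{d/k}+c₁₁}`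
is expressed by the existence of an `L_p` `ε`-cover of that cardinality.  The constants do
not depend on `K_n`, `α`, `β`, `A`, `B`, `C`, `p`, `ε`, `n` or the points. -/
theorem covering_number_bound
    (d L r k : ℕ) (hk : 0 < k) (σ : ℝ → ℝ)
    (hσ : ContDiff ℝ (k : ℕ∞) σ)
    (hσbdd : ∀ i ≤ k, ∃ M : ℝ, ∀ x, |iteratedDeriv i σ x| ≤ M) :
    ∃ c9 c10 c11 : ℝ, 0 < c9 ∧ 0 < c10 ∧ 0 < c11 ∧
      ∀ (K : ℕ) (α β A B C p ε : ℝ), 1 ≤ α → 0 < β → 1 ≤ A → 1 ≤ B → 1 ≤ C →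
        1 ≤ p → 0 < ε → ε < β →
        ∀ (n : ℕ) (xs : Fin n → Fin d → ℝ),
          ∃ (N : ℕ) (g : Fin N → (Fin d → ℝ) → ℝ),
            IsLpCover p ε
              {f : (Fin d → ℝ) → ℝ |
                ∃ w : NNIdx K L r d → ℝ,
                  (∑ j : Fin K, |w (NNIdx.out j)| ≤ C) ∧
                  (∀ (kk : Fin K) (i : Fin r) (l : Fin (L - 1)) (j : Fin r),
                    |w (NNIdx.inner l kk i j.succ)| ≤ B) ∧
                  (∀ (kk : Fin K) (i : Fin r) (j : Fin d),
                    |w (NNIdx.input kk i j.succ)| ≤ A) ∧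
                  f = Set.indicator {x : Fin d → ℝ | ∀ j, |x j| ≤ α}
                        (fun x => trunc β (fnet σ K L r d w x))}
              xs g ∧
            (N : ℝ) ≤ (c9 * β ^ p / ε ^ p)
              ^ (c10 * α ^ d * B ^ ((L - 1) * d) * A ^ d * (C / ε) ^ ((d : ℝ) / (k : ℝ))
                  + c11) := by
  rcases Nat.eq_zero_or_pos d with rfl | hd
  · exact dim_zero L r k σ
  have hσ : ContDiff ℝ (k : ℕ) σ := hσ
  obtain ⟨S, hS1, hS⟩ : ∃ S : ℝ, 1 ≤ S ∧ ∀ i ≤ k, ∀ x, |iteratedDeriv i σ x| ≤ S := by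
    choose! M hM using hσbdd
    refine ⟨1 + ∑ i ∈ Finset.range (k+1), |M i|, ?_, ?_⟩
    · have : 0 ≤ ∑ i ∈ Finset.range (k+1), |M i| := Finset.sum_nonneg fun _ _ => abs_nonneg _
      linarith
    · intro i hi x
      have h1 := Finset.single_le_sum (f := fun i => |M i|) (fun _ _ => abs_nonneg _)
        (Finset.mem_range.2 (Nat.lt_succ_of_le hi))
      have h2 := hM i hi x
      have h3 := le_abs_self (M i)
      linarith
  obtain ⟨c, a, hc, ha, hKT⟩ := KT d k hk
  have hf1 : (1:ℝ) ≤ k.factorial := by exact_mod_cast Nat.succ_le_of_lt k.factorial_pos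
  set Q := k.factorial * S with hQd
  have hQ : 1 ≤ Q := one_le_mul_of_one_le_of_one_le hf1 hS1
  have hk' : (0:ℝ) < k := by exact_mod_cast hk
  set P := ((r+1) * Q) ^ (L-1) with hP
  have hP0 : 0 < P := by positivity
  set c' := 2 * P * (2 * c * Q) ^ ((1:ℝ)/k) with hc'
  have hc'0 : 0 ≤ c' := by positivity
  set c2 := c' + k + 2 with hc2
  set b := 4 * c * Q + 5 with hb
  have hb1 : 1 ≤ b := by have : 0 ≤ c * Q := by positivity
                         linarith
  have hla : 0 ≤ Real.log a := Real.log_nonneg ha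
  have hlb : 0 ≤ Real.log (2 * b) := Real.log_nonneg (by linarith)
  refine ⟨Real.exp 1, Real.log a * c2 ^ d * 2 ^ d + k ^ d * k,
    Real.log a * c2 ^ d * 2 ^ d + k ^ d * Real.log (2 * b) + 1, Real.exp_pos _, by positivity,
    by positivity, ?_⟩
  intro K α β A B C p ε hα hβ hA hB hC hp hε hεβ n xs
  set y := C / ε with hy
  have hy0 : 0 < y := by positivity
  set η := ε / (2 * c) with hη
  have hη0 : 0 < η := by positivity
  set δ := (η / (C * Q)) ^ ((1:ℝ)/k) / (P * B ^ (L-1) * A) with hδ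
  have hδ0 : 0 < δ := by positivity
  set X := α * B ^ (L-1) * A * y ^ ((1:ℝ)/k) with hX
  have hX0 : 0 ≤ X := by positivity
  have hXd : X ^ d = α ^ d * B ^ ((L-1)*d) * A ^ d * y ^ ((d:ℝ)/k) := by
    rw [hX, mul_pow, mul_pow, mul_pow, ← pow_mul, ← Real.rpow_natCast (y ^ ((1:ℝ)/k)),
      ← Real.rpow_mul hy0.le, one_div_mul_eq_div]
  have hsc : C * (Q * (((r+1) * Q * B) ^ (L-1) * (A * δ)) ^ k) = η := by
    have e : ((r+1) * Q * B) ^ (L-1) * (A * δ) = (η / (C * Q)) ^ ((1:ℝ)/k) := by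
      rw [mul_pow ((r+1) * Q) B, ← hP, hδ]; field_simp
    rw [e, ← Real.rpow_natCast, ← Real.rpow_mul (by positivity), one_div_mul_cancel hk'.ne',
      Real.rpow_one]
    field_simp
  have hδX : 2 * α / δ = c' * X := by
    have e : η / (C * Q) = (2 * c * Q * y)⁻¹ := by
      rw [hη, hy]; field_simp
    rw [hδ, e, Real.inv_rpow (by positivity), Real.mul_rpow (by positivity) hy0.le, hc', hX]
    field_simp
  set M := ⌈2 * α / δ⌉₊ + k with hM
  obtain ⟨N, g, hg, hN⟩ := hKT M η (C * Q) (by omega) hη0 (by positivity)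
    {F | ∃ w : NNIdx K L r d → ℝ,
                  (∑ j : Fin K, |w (NNIdx.out j)| ≤ C) ∧
                  (∀ (kk : Fin K) (i : Fin r) (l : Fin (L - 1)) (j : Fin r),
                    |w (NNIdx.inner l kk i j.succ)| ≤ B) ∧
                  (∀ (kk : Fin K) (i : Fin r) (j : Fin d),
                    |w (NNIdx.input kk i j.succ)| ≤ A) ∧
        F = fun z => fnet σ K L r d w (fun j => -α + δ * z j)} (by
      rintro F ⟨w, hwC, hwB, hwA, rfl⟩
      constructor
      · intro z j s
        have h := fnet_deriv k σ hσ S hS1 hS K L r d w A B C δ hA hB hδ0.le hwC hwB hwA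
          (Pi.single j δ) (fun x => -α + δ * Function.update z j s x) (by
            rw [Finset.sum_eq_single j]
            · simp [abs_of_pos hδ0]
            · intro x _ hx; simp [hx]
            · simp)
        have e : (fun t : ℝ => fnet σ K L r d w (fun x => -α + δ * Function.update z j (s + t) x))
          = (fun t : ℝ => fnet σ K L r d w
            (fun x => (-α + δ * Function.update z j s x) + t * (Pi.single j δ : Fin d → ℝ) x)) := by
          ext t
          congr 1
          ext x
          by_cases hx : x = j
          · subst hx; simp; ring
          · simp [hx]
        rw [e]
        refine ⟨h.1, fun t => ?_⟩
        have := h.2 k le_rfl t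
        rw [← hQd, hsc] at this
        exact this
      · intro z
        have h := fnet_deriv k σ hσ S hS1 hS K L r d w A B C 0 hA hB le_rfl hwC hwB hwA
          0 (fun x => -α + δ * z x) (by simp)
        have := h.2 0 (by omega) 0
        simpa using this)
  refine ⟨N, fun i => Set.indicator {x : Fin d → ℝ | ∀ j, |x j| ≤ α}
      (fun x => trunc β (g i (fun j => (x j + α) / δ))), ?_, ?_⟩
  · rintro f ⟨w, hwC, hwB, hwA, rfl⟩
    obtain ⟨i, hi⟩ := hg _ ⟨w, hwC, hwB, hwA, rfl⟩
    refine ⟨i, mean_le _ (ε / 2) ε p (by positivity) (by linarith) hp fun s => ?_⟩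
    beta_reduce
    by_cases hx : xs s ∈ {x : Fin d → ℝ | ∀ j, |x j| ≤ α}
    · rw [Set.indicator_of_mem hx, Set.indicator_of_mem hx]
      refine (trunc_lip _ _ _).trans ?_
      have := hi (fun j => (xs s j + α) / δ) (fun j => by
        have hxj := abs_le.1 (hx j)
        refine ⟨div_nonneg (by linarith) hδ0.le, ?_⟩
        calc (xs s j + α) / δ ≤ 2 * α / δ := by gcongr; linarith
          _ ≤ ⌈2 * α / δ⌉₊ := Nat.le_ceil _
          _ ≤ M := by rw [hM]; push_cast; linarith)
      have e : (fun j => -α + δ * ((xs s j + α) / δ)) = xs s := by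
        ext j; field_simp; ring
      simp only [e] at this
      refine this.trans (le_of_eq ?_)
      rw [hη]; field_simp
    · rw [Set.indicator_of_notMem hx, Set.indicator_of_notMem hx]
      simp; positivity
  · have hyX : y ^ ((d:ℝ)/k) ≤ X ^ d := by
      rw [hXd]
      refine le_mul_of_one_le_left (by positivity) ?_
      exact one_le_mul_of_one_le_of_one_le (one_le_mul_of_one_le_of_one_le
        (one_le_pow₀ hα) (one_le_pow₀ hB)) (one_le_pow₀ hA)
    have hRη : C * Q / η = 2 * c * Q * y := by
      rw [hη, hy]; field_simp
    have hfin := num_bound d k hd hk a c2 b ha (by positivity) hb1 X y N (2 * (C * Q / η) + 5) M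
      hX0 hy0 hyX (by
        have := (Nat.ceil_lt_add_one (by positivity : 0 ≤ 2 * α / δ)).le
        rw [hM]; push_cast
        rw [hδX] at this ⊢
        nlinarith) (by positivity) (by
        rw [hRη]
        have : 0 ≤ c * Q := by positivity
        nlinarith) hN
    have hE : (Real.log a * c2 ^ d * 2 ^ d + k ^ d * k) * X ^ d
        = (Real.log a * c2 ^ d * 2 ^ d + k ^ d * k) * α ^ d * B ^ ((L - 1) * d) * A ^ d
          * y ^ ((d : ℝ) / (k : ℝ)) := by
      rw [hXd]; ring
    rw [hE] at hfin
    have hE0 : 0 ≤ (Real.log a * c2 ^ d * 2 ^ d + k ^ d * k) * α ^ d * B ^ ((L - 1) * d) * A ^ d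
          * y ^ ((d : ℝ) / (k : ℝ))
          + (Real.log a * c2 ^ d * 2 ^ d + k ^ d * Real.log (2 * b) + 1) := by positivity
    exact final_num _ _ β ε p hε hεβ hp hE0 hfin
end
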